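/- Let μ be an unbounded sequence of positive integers, a ∈ ℂ ∖ 𝔻, and q ≥ 1 an integer; set Q_p(z) = (1 − z/a)^p for 0 ≤ p ≤ q. Then the set 𝒰̃_{Q_q}^μ(𝔻) := ⋃_{p=0}^q 𝒰_{Q_p}^μ(𝔻) is algebraically generic: there exists a sequence of functions f_k ∈ 𝒰_{Q_q}^μ(𝔻), k ≥ 0, such that the linear span F = span(f_k, k ≥ 0) is dense in H(𝔻) and F ∖ {0} ⊂ 𝒰̃_{Q_q}^μ(𝔻). -/

import Mathlib

open Polynomial Filter Finset Metric Topology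

noncomputable section

/-- Coefficient sequence extended to integer indices, with `a k = 0` for `k < 0`. -/
def acoefZ (a : ℕ → ℂ) (k : ℤ) : ℂ := if 0 ≤ k then a k.toNat else 0

/-- The Hankel determinant `C_{m,n} = det (a_{m-n+1+i+j})_{0 ≤ i,j ≤ n-1}`. -/
def hankelDet (a : ℕ → ℂ) (m n : ℕ) : ℂ :=
  Matrix.det (Matrix.of fun i j : Fin n => acoefZ a ((m : ℤ) - n + 1 + i + j))

/-- `IsPade a m n P Q` : the rational function `P/Q` is the Padé approximant of type
`(m,n)` of the formal power series `∑ a_k z^k`. -/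
def IsPade (a : ℕ → ℂ) (m n : ℕ) (P Q : Polynomial ℂ) : Prop :=
  P.natDegree ≤ m ∧ Q.natDegree ≤ n ∧ IsCoprime P Q ∧ Q.coeff 0 = 1 ∧
    ∀ j ≤ m + n, (∑ i ∈ Finset.range (j + 1), Q.coeff i * a (j - i)) = P.coeff j

/-- `𝒟_{m,n}` : the set of coefficient sequences whose Hankel determinant `C_{m,n}`
does not vanish. -/
def Dset (m n : ℕ) : Set (ℕ → ℂ) := {a | hankelDet a m n ≠ 0}

/-- `𝒩_{m,n}` : the subset of `𝒟_{m,n}` of series whose Padé denominator has exact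
degree `n`. -/
def Nset (m n : ℕ) : Set (ℕ → ℂ) :=
  {a | hankelDet a m n ≠ 0 ∧
    ∃ P Q : Polynomial ℂ, IsPade a m n P Q ∧ Q.degree = (n : WithBot ℕ)}

/-- The open unit disc in `ℂ`. -/
def unitD : Set ℂ := Metric.ball (0 : ℂ) 1

/-- The submodule of `ℂ → ℂ` of functions holomorphic on `Ω` (normalized to vanish
outside `Ω`, so that a function is determined by its restriction to `Ω`). -/
def holSubmodule (Ω : Set ℂ) : Submodule ℂ (ℂ → ℂ) where
  carrier := {f | DifferentiableOn ℂ f Ω ∧ ∀ z ∉ Ω, f z = 0}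
  add_mem' := fun hf hg => ⟨hf.1.add hg.1, fun z hz => by simp [hf.2 z hz, hg.2 z hz]⟩
  zero_mem' := ⟨differentiableOn_const 0, fun _ _ => rfl⟩
  smul_mem' := fun c f hf => ⟨hf.1.const_smul c, fun z hz => by simp [hf.2 z hz]⟩

/-- `H(Ω)`, the space of holomorphic functions on `Ω`. -/
abbrev Hol (Ω : Set ℂ) := ↥(holSubmodule Ω)

/-- The topology of uniform convergence on compact subsets of `Ω` on `H(Ω)`. -/
instance holTop (Ω : Set ℂ) : TopologicalSpace (Hol Ω) :=
  TopologicalSpace.induced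
    (fun f : Hol Ω => UniformOnFun.ofFun {K : Set Ω | IsCompact K} fun z : Ω => f.1 z)
    inferInstance

/-- The `k`-th Taylor coefficient at `0` of a function `f`. -/
def tc (f : ℂ → ℂ) (k : ℕ) : ℂ := iteratedDeriv k f 0 / k.factorial

/-- `𝒰_Q^μ(𝔻)` : the set of `f ∈ H(𝔻)` such that for every compact `K` avoiding
`𝔻 ∪ E` with connected complement, and every `h ∈ A(K)`, some subsequence
`(λ_n) = (μ (σ n))` of `μ` satisfies : a) `f ∈ 𝒩_{λ_n,q}`; b) `[f; λ_n/q] → h` in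
`A(K)`; c) `[f; λ_n/q] → f` in `H(𝔻)`; d) the Padé denominator `Q_{λ_n,q}(f)` equals
the prescribed polynomial `Qp`. -/
def UQset (μ : ℕ → ℕ) (q : ℕ) (Qp : Polynomial ℂ) (E : Set ℂ) : Set (Hol unitD) :=
  {f | ∀ K : Set ℂ, IsCompact K → Disjoint K (unitD ∪ E) → IsConnected Kᶜ →
    ∀ h : ℂ → ℂ, ContinuousOn h K → DifferentiableOn ℂ h (interior K) →
    ∃ σ : ℕ → ℕ, StrictMono σ ∧ ∃ P : ℕ → Polynomial ℂ,
      (∀ k, tc f.1 ∈ Nset (μ (σ k)) q ∧ IsPade (tc f.1) (μ (σ k)) q (P k) Qp) ∧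
      TendstoUniformlyOn (fun k z => (P k).eval z / Qp.eval z) h atTop K ∧
      TendstoLocallyUniformlyOn (fun k z => (P k).eval z / Qp.eval z) f.1 atTop unitD}
/-- `𝒰̃_{Q_q}^μ(𝔻) = ⋃_{p=0}^q 𝒰_{Q_p}^μ(𝔻)` where `Q_p(z) = (1 - z/a)^p` (for `p = 0`,
`Q_0 = 1` and the Padé approximants along the `0`-th row are the Taylor partial
sums). -/
def Utilde (μ : ℕ → ℕ) (a : ℂ) (q : ℕ) : Set (Hol unitD) :=
  ⋃ p ∈ Set.Iic q,
    UQset μ p ((1 - Polynomial.C a⁻¹ * Polynomial.X) ^ p)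
      {z : ℂ | ((1 - Polynomial.C a⁻¹ * Polynomial.X) ^ p).eval z = 0}

/-- `f` is a uniform limit on `K` of polynomials. -/
def PolyApprox (K : Set ℂ) (f : ℂ → ℂ) : Prop :=
  ∀ ε > 0, ∃ p : ℂ[X], ∀ z ∈ K, ‖p.eval z - f z‖ < ε

namespace PolyApprox

variable {K L : Set ℂ} {f g φ : ℂ → ℂ}

theorem polynomial (K : Set ℂ) (p : ℂ[X]) : PolyApprox K fun z => p.eval z :=
  fun ε hε => ⟨p, fun z _ => by simpa using hε⟩

theorem const (K : Set ℂ) (c : ℂ) : PolyApprox K fun _ => c := by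
  simpa using polynomial K (C c)

theorem congr (hf : PolyApprox K f) (h : ∀ z ∈ K, f z = g z) : PolyApprox K g :=
  fun ε hε => (hf ε hε).imp fun _ hp z hz => h z hz ▸ hp z hz

theorem of_forall_exists (h : ∀ ε > 0, ∃ g, PolyApprox K g ∧ ∀ z ∈ K, ‖g z - f z‖ < ε) :
    PolyApprox K f := by
  intro ε hε
  obtain ⟨g, hg, hgf⟩ := h (ε / 2) (half_pos hε)
  obtain ⟨p, hp⟩ := hg (ε / 2) (half_pos hε)
  refine ⟨p, fun z hz => ?_⟩
  have := norm_sub_le_norm_sub_add_norm_sub (p.eval z) (g z) (f z)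
  linarith [hp z hz, hgf z hz]

theorem add (hf : PolyApprox K f) (hg : PolyApprox K g) : PolyApprox K fun z => f z + g z := by
  intro ε hε
  obtain ⟨p, hp⟩ := hf (ε / 2) (half_pos hε)
  obtain ⟨r, hr⟩ := hg (ε / 2) (half_pos hε)
  refine ⟨p + r, fun z hz => ?_⟩
  rw [eval_add, add_sub_add_comm]
  linarith [norm_add_le (p.eval z - f z) (r.eval z - g z), hp z hz, hr z hz]

theorem exists_bound (hK : IsCompact K) (hf : PolyApprox K f) : ∃ M > 0, ∀ z ∈ K, ‖f z‖ ≤ M := by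
  obtain ⟨p, hp⟩ := hf 1 one_pos
  obtain ⟨B, hB⟩ := hK.exists_bound_of_continuousOn (f := fun z => p.eval z) p.continuous.continuousOn
  refine ⟨|B| + 1, by positivity, fun z hz => ?_⟩
  have := norm_sub_norm_le (f z) (p.eval z)
  rw [norm_sub_rev] at this
  linarith [hp z hz, hB z hz, le_abs_self B]

theorem mul (hK : IsCompact K) (hf : PolyApprox K f) (hg : PolyApprox K g) :
    PolyApprox K fun z => f z * g z := by
  obtain ⟨M, hM, hfM⟩ := hf.exists_bound hK
  intro ε hε
  obtain ⟨r, hr⟩ := hg (ε / (2 * M)) (by positivity)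
  obtain ⟨N, hN, hrN⟩ := (polynomial K r).exists_bound hK
  obtain ⟨p, hp⟩ := hf (ε / (2 * N)) (by positivity)
  refine ⟨p * r, fun z hz => ?_⟩
  rw [eval_mul, show p.eval z * r.eval z - f z * g z
    = (p.eval z - f z) * r.eval z + f z * (r.eval z - g z) by ring]
  refine (norm_add_le _ _).trans_lt ?_
  rw [norm_mul, norm_mul]
  have h1 : ‖p.eval z - f z‖ * ‖r.eval z‖ ≤ ‖p.eval z - f z‖ * N := by
    gcongr; exact hrN z hz
  have h2 : ‖p.eval z - f z‖ * N < ε / (2 * N) * N := by gcongr; exact hp z hz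
  have h3 : ‖f z‖ * ‖r.eval z - g z‖ ≤ M * (ε / (2 * M)) := by
    gcongr
    · exact hfM z hz
    · exact (hr z hz).le
  have h4 : ε / (2 * N) * N = ε / 2 := by field_simp
  have h5 : M * (ε / (2 * M)) = ε / 2 := by field_simp
  linarith

theorem const_mul (hK : IsCompact K) (c : ℂ) (hf : PolyApprox K f) :
    PolyApprox K fun z => c * f z := (const K c).mul hK hf

theorem sub (hK : IsCompact K) (hf : PolyApprox K f) (hg : PolyApprox K g) :
    PolyApprox K fun z => f z - g z :=
  (hf.add (hg.const_mul hK (-1))).congr fun z _ => by ring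

theorem sum {ι : Type*} (s : Finset ι) {F : ι → ℂ → ℂ} (h : ∀ i ∈ s, PolyApprox K (F i)) :
    PolyApprox K fun z => ∑ i ∈ s, F i z := by
  classical
  induction s using Finset.induction_on with
  | empty => simpa using const K 0
  | insert a s ha ih =>
    simp only [Finset.sum_insert ha]
    exact (h a (by simp)).add (ih fun i hi => h i (by simp [hi]))

theorem pow (hK : IsCompact K) (hf : PolyApprox K f) (n : ℕ) : PolyApprox K fun z => f z ^ n := by
  induction n with
  | zero => simpa using const K 1
  | succ n ih => simpa only [pow_succ] using ih.mul hK hf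

theorem comp (hK : IsCompact K) (hφ : PolyApprox L φ) (hf : PolyApprox K f)
    (hfL : ∀ z ∈ K, f z ∈ L) : PolyApprox K fun z => φ (f z) := by
  refine of_forall_exists fun ε hε => ?_
  obtain ⟨p, hp⟩ := hφ ε hε
  refine ⟨fun z => p.eval (f z), ?_, fun z hz => hp _ (hfL z hz)⟩
  simp only [eval_eq_sum_range]
  exact sum _ fun i _ => (hf.pow hK i).const_mul hK _

end PolyApprox

/-- The partial sums of the Taylor series of a holomorphic function on a disc converge to it
uniformly on smaller discs. -/
theorem tendstoUniformlyOn_sum_tc {f : ℂ → ℂ} {R r : ℝ} (hf : DifferentiableOn ℂ f (ball 0 R))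
    (hr : r < R) :
    TendstoUniformlyOn (fun n z => ∑ j ∈ range n, tc f j * z ^ j) f atTop (closedBall 0 r) := by
  rcases lt_or_ge r 0 with h0 | h0
  · simp [closedBall_eq_empty.2 h0, TendstoUniformlyOn]
  obtain ⟨s, hrs, hsR⟩ := exists_between hr
  obtain ⟨t, hst, htR⟩ := exists_between hsR
  have ht : 0 < t := by linarith
  lift t to NNReal using ht.le
  lift s to NNReal using by linarith
  have h1 := (hf.mono (closedBall_subset_ball htR)).hasFPowerSeriesOnBall (by exact_mod_cast ht)
  have h2 : AnalyticAt ℂ f 0 := h1.analyticAt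
  have h3 := h1.hasFPowerSeriesAt.eq_formalMultilinearSeries h2.hasFPowerSeriesAt
  rw [h3] at h1
  have h4 := h1.tendstoUniformlyOn (r' := s) (by exact_mod_cast hst)
  refine ((h4.mono (closedBall_subset_ball hrs)).congr_right ?_).congr ?_
  · intro z _; simp
  · refine Eventually.of_forall fun n z _ => ?_
    simp [FormalMultilinearSeries.partialSum, FormalMultilinearSeries.ofScalars, tc, mul_comm]

theorem PolyApprox.of_differentiableOn {f : ℂ → ℂ} {R r : ℝ}
    (hf : DifferentiableOn ℂ f (ball 0 R)) (hr : r < R) : PolyApprox (closedBall 0 r) f := by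
  intro ε hε
  have h := Metric.tendstoUniformlyOn_iff.1 (tendstoUniformlyOn_sum_tc hf hr) ε hε
  obtain ⟨n, hn⟩ := h.exists
  refine ⟨∑ j ∈ range n, C (tc f j) * X ^ j, fun z hz => ?_⟩
  have := hn z hz
  rw [dist_comm, dist_eq_norm] at this
  simpa [eval_finsetSum] using this

theorem PolyApprox.inv_sub {K : Set ℂ} (hK : IsCompact K) (hc : IsConnected Kᶜ) {p : ℂ}
    (hp : p ∉ K) : PolyApprox K fun z => (z - p)⁻¹ := by
  have : CompactSpace K := isCompact_iff_compactSpace.1 hK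
  let S := (polynomialFunctions K).topologicalClosure
  have hS : IsClosed (S : Set C(K, ℂ)) := Subalgebra.isClosed_topologicalClosure _
  let x : S := ⟨X.toContinuousMapOn K,
    Subalgebra.le_topologicalClosure _ ⟨X, Algebra.mem_top, rfl⟩⟩
  have hx : spectrum ℂ (x : C(K, ℂ)) = K := by
    rw [ContinuousMap.spectrum_eq_range]
    ext z
    simp [x]
  have h := Subalgebra.spectrum_eq_of_isPreconnected_compl (𝕜 := ℂ) S x
    (by rw [hx]; exact hc.isPreconnected)
  rw [hx] at h
  have hp' : p ∉ spectrum ℂ x := by rwa [h]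
  rw [spectrum.notMem_iff] at hp'
  obtain ⟨u, hu⟩ := hp'
  have hmem : ((↑u⁻¹ : S) : C(K, ℂ)) ∈ closure (polynomialFunctions K : Set C(K, ℂ)) :=
    (↑u⁻¹ : S).2
  have hval : ∀ z : K, (p - z) * ((↑u⁻¹ : S) : C(K, ℂ)) z = 1 := by
    intro z
    have h1 : ((u : S) : C(K, ℂ)) * ((↑u⁻¹ : S) : C(K, ℂ)) = 1 :=
      congrArg (fun s : S => (s : C(K, ℂ))) u.mul_inv
    have h2 := congrArg (fun s : C(K, ℂ) => s z) h1
    rw [hu] at h2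
    simpa [x] using h2
  intro ε hε
  obtain ⟨_, ⟨P, -, rfl⟩, hP⟩ := Metric.mem_closure_iff.1 hmem ε hε
  refine ⟨-P, fun z hz => ?_⟩
  have h1 := (ContinuousMap.dist_lt_iff hε).1 hP ⟨z, hz⟩
  have h2 := hval ⟨z, hz⟩
  have h3 : z - p ≠ 0 := fun h => hp (by rwa [← sub_eq_zero.1 h])
  have h4 : ((↑u⁻¹ : S) : C(K, ℂ)) ⟨z, hz⟩ = -(z - p)⁻¹ := by
    rw [neg_inv, neg_sub]
    exact eq_inv_of_mul_eq_one_right h2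
  rw [h4, dist_comm, dist_eq_norm] at h1
  change ‖P.eval z - -(z - p)⁻¹‖ < ε at h1
  rwa [← norm_neg, eval_neg, neg_sub, sub_neg_eq_add, add_comm, ← sub_neg_eq_add]

/-- There is a branch of `log ((z - q) / (z - p))` on `K` and near infinity which is a uniform limit
of polynomials on `K` and vanishes at infinity. -/
def LogRel (K : Set ℂ) (c p q : ℂ) : Prop :=
  ∃ L : ℂ → ℂ, ContinuousOn L {z | 2 < ‖z - c‖} ∧
    (∀ z, z ∈ K ∨ 2 < ‖z - c‖ → (z - p) * Complex.exp (L z) = z - q) ∧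
    Tendsto L (Bornology.cobounded ℂ) (𝓝 0) ∧ PolyApprox K L

theorem LogRel.trans {K : Set ℂ} {c p q r : ℂ} (h₁ : LogRel K c p q) (h₂ : LogRel K c q r) :
    LogRel K c p r := by
  obtain ⟨L₁, c₁, e₁, t₁, a₁⟩ := h₁
  obtain ⟨L₂, c₂, e₂, t₂, a₂⟩ := h₂
  refine ⟨fun z => L₁ z + L₂ z, c₁.add c₂, fun z hz => ?_, by simpa using t₁.add t₂, a₁.add a₂⟩
  rw [Complex.exp_add, ← mul_assoc, e₁ z hz, e₂ z hz]

theorem LogRel.symm {K : Set ℂ} (hK : IsCompact K) {c p q : ℂ} (h : LogRel K c p q) :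
    LogRel K c q p := by
  obtain ⟨L, hc, he, ht, ha⟩ := h
  refine ⟨fun z => -L z, hc.neg, fun z hz => ?_, by simpa using ht.neg,
    (ha.const_mul hK (-1)).congr fun z _ => by ring⟩
  rw [← he z hz, mul_assoc, ← Complex.exp_add]
  simp

theorem LogRel.of_near {K : Set ℂ} (hK : IsCompact K) (hc : IsConnected Kᶜ) {c x y : ℂ} {ρ : ℝ}
    (hxc : ‖x - c‖ ≤ 1) (hρ : 0 < ρ) (hxK : ∀ z ∈ K, ρ ≤ ‖z - x‖) (hy : ‖x - y‖ < ρ)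
    (hy1 : ‖x - y‖ < 1) : LogRel K c x y := by
  have hfar : ∀ z, 2 < ‖z - c‖ → 1 < ‖z - x‖ := fun z hz => by
    have := norm_sub_le_norm_sub_add_norm_sub z x c
    linarith
  have hsmall : ∀ z, z ∈ K ∨ 2 < ‖z - c‖ → z - x ≠ 0 ∧ ‖(x - y) * (z - x)⁻¹‖ < 1 := by
    rintro z (hz | hz)
    · have h := hxK z hz
      refine ⟨norm_pos_iff.1 (hρ.trans_le h), ?_⟩
      rw [norm_mul, norm_inv, ← div_eq_mul_inv, div_lt_one (hρ.trans_le h)]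
      exact hy.trans_le h
    · have h := hfar z hz
      refine ⟨norm_pos_iff.1 (one_pos.trans h), ?_⟩
      rw [norm_mul, norm_inv, ← div_eq_mul_inv, div_lt_one (one_pos.trans h)]
      exact hy1.trans h
  have hxK' : x ∉ K := fun h => by simpa using hρ.trans_le (hxK x h)
  refine ⟨fun z => Complex.log (1 + (x - y) * (z - x)⁻¹), ?_, ?_, ?_, ?_⟩
  · refine ContinuousOn.clog ?_ fun z hz => Complex.mem_slitPlane_of_norm_lt_one (hsmall z (.inr hz)).2
    refine continuousOn_const.add (continuousOn_const.mul (ContinuousOn.inv₀ (by fun_prop) ?_))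
    exact fun z hz => (hsmall z (.inr hz)).1
  · intro z hz
    obtain ⟨h1, h2⟩ := hsmall z hz
    rw [Complex.exp_log (Complex.slitPlane_ne_zero (Complex.mem_slitPlane_of_norm_lt_one h2))]
    field_simp
    ring
  · have h1 : Tendsto (fun z : ℂ => z - x) (Bornology.cobounded ℂ) (Bornology.cobounded ℂ) := by
      simp [sub_eq_add_neg]
    have h2 := (tendsto_inv₀_cobounded.comp h1).const_mul (x - y)
    have h3 : Tendsto (fun z => 1 + (x - y) * (z - x)⁻¹) (Bornology.cobounded ℂ) (𝓝 1) := by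
      simpa using h2.const_add 1
    simpa using h3.clog (by simp)
  · have h1 : PolyApprox (closedBall 0 (‖x - y‖ / ρ)) fun w => Complex.log (1 + w) := by
      refine PolyApprox.of_differentiableOn (R := 1) ?_ (by rwa [div_lt_one hρ])
      refine DifferentiableOn.clog (by fun_prop) fun z hz => ?_
      exact Complex.mem_slitPlane_of_norm_lt_one (by simpa using hz)
    refine PolyApprox.comp (f := fun z => (x - y) * (z - x)⁻¹) hK h1
      ((PolyApprox.inv_sub hK hc hxK').const_mul hK _) fun z hz => ?_
    rw [mem_closedBall_zero_iff, norm_mul, norm_inv, ← div_eq_mul_inv]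
    gcongr
    exact hxK z hz

theorem exists_norm_gt_of_isCompact {K : Set ℂ} (hK : IsCompact K) (c : ℂ) (R : ℝ) :
    ∃ y ∈ Kᶜ, R < ‖y - c‖ := by
  obtain ⟨r, hr⟩ := hK.isBounded.subset_closedBall c
  refine ⟨c + ((max |r| |R| + 1 : ℝ) : ℂ), fun h => ?_, ?_⟩
  · have := hr h
    rw [mem_closedBall, dist_eq_norm, add_sub_cancel_left, Complex.norm_real, Real.norm_eq_abs] at this
    have h1 := le_abs_self (max |r| |R| + 1)
    have h2 := le_max_left |r| |R|
    linarith [le_abs_self r]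
  · rw [add_sub_cancel_left, Complex.norm_real, Real.norm_eq_abs]
    have h1 := le_abs_self (max |r| |R| + 1)
    have h2 := le_max_right |r| |R|
    linarith [le_abs_self R]

theorem exists_logRel {K : Set ℂ} (hK : IsCompact K) (hc : IsConnected Kᶜ) {c : ℂ} (hcK : c ∉ K) :
    ∃ q, ‖c - q‖ = 1 ∧ LogRel K c c q := by
  obtain ⟨y, hyK, hy⟩ := exists_norm_gt_of_isCompact hK c 1
  have hpc : IsPathConnected Kᶜ := (hK.isClosed.isOpen_compl.isConnected_iff_isPathConnected).1 hc
  obtain ⟨γ, hγ⟩ := hpc.joinedIn c hcK y hyK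
  have hγK : ∀ t, γ.extend t ∈ Kᶜ := fun t => hγ _
  have hcont : Continuous fun t => ‖γ.extend t - c‖ := by fun_prop
  have h0 : ‖γ.extend 0 - c‖ = 0 := by simp
  have hT : IsCompact (Set.Icc (0 : ℝ) 1 ∩ {t | ‖γ.extend t - c‖ = 1}) :=
    isCompact_Icc.inter_right (isClosed_eq hcont continuous_const)
  have hne : (Set.Icc (0 : ℝ) 1 ∩ {t | ‖γ.extend t - c‖ = 1}).Nonempty := by
    obtain ⟨t, ht, ht'⟩ := intermediate_value_Icc (zero_le_one' ℝ) hcont.continuousOn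
      (show (1 : ℝ) ∈ _ by rw [h0]; simp [hy.le])
    exact ⟨t, ht, ht'⟩
  obtain ⟨t₀, ⟨ht₀, ht₀'⟩, hmin⟩ := hT.exists_isLeast hne
  have hle : ∀ t ∈ Set.Icc 0 t₀, ‖γ.extend t - c‖ ≤ 1 := by
    intro t ht
    by_contra! h
    obtain ⟨u, hu, hu'⟩ := intermediate_value_Icc ht.1 hcont.continuousOn
      (show (1 : ℝ) ∈ _ by rw [h0]; simp [h.le])
    have h1 := hmin ⟨⟨hu.1, hu.2.trans (ht.2.trans ht₀.2)⟩, hu'⟩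
    have h2 : u = t := le_antisymm hu.2 (ht.2.trans h1)
    rw [h2] at hu'
    exact h.ne' hu'
  have hpre : IsPreconnected (γ.extend '' Set.Icc 0 t₀) :=
    isPreconnected_Icc.image _ (by fun_prop)
  refine ⟨γ.extend t₀, by rw [norm_sub_rev]; exact ht₀', ?_⟩
  refine hpre.induction₂ (LogRel K c) ?_ (fun _ _ _ _ _ _ => LogRel.trans)
    (fun _ _ _ _ => LogRel.symm hK) ⟨0, ⟨le_rfl, ht₀.1⟩, by simp⟩ ⟨t₀, ⟨ht₀.1, le_rfl⟩, rfl⟩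
  rintro _ ⟨t, ht, rfl⟩
  obtain ⟨ρ, hρ, hball⟩ := Metric.isOpen_iff.1 hK.isClosed.isOpen_compl _ (hγK t)
  filter_upwards [mem_nhdsWithin_of_mem_nhds (ball_mem_nhds (γ.extend t) (lt_min hρ one_pos))]
    with y hy
  rw [mem_ball, dist_comm, dist_eq_norm, lt_min_iff] at hy
  refine LogRel.of_near hK hc (hle t ht) hρ (fun z hz => ?_) hy.1 hy.2
  by_contra! h
  exact hball (by rwa [mem_ball, dist_eq_norm]) hz

theorem LogRel.exp_half_re_pos {c q : ℂ} (hq : ‖c - q‖ = 1) {L : ℂ → ℂ}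
    (hL : ContinuousOn L {z | 2 < ‖z - c‖})
    (he : ∀ z, 2 < ‖z - c‖ → (z - c) * Complex.exp (L z) = z - q)
    (ht : Tendsto L (Bornology.cobounded ℂ) (𝓝 0)) {z : ℂ} (hz : 2 < ‖z - c‖) :
    0 < (Complex.exp (L z / 2)).re := by
  have hne : ∀ z, 2 < ‖z - c‖ → (Complex.exp (L z / 2)).re ≠ 0 := by
    intro z hz h
    have hz0 : z - c ≠ 0 := norm_pos_iff.1 (by linarith)
    have h1 : Complex.exp (L z / 2) ^ 2 = 1 + (c - q) / (z - c) := by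
      rw [← Complex.exp_nat_mul, show ((2 : ℕ) : ℂ) * (L z / 2) = L z by push_cast; ring]
      field_simp
      linear_combination he z hz
    have h2 : ‖(c - q) / (z - c)‖ < 1 := by
      rw [norm_div, hq, div_lt_one (by linarith)]
      linarith
    have h3 := congrArg Complex.re h1
    rw [sq, Complex.mul_re, h] at h3
    have h4 := (Complex.abs_re_le_norm _).trans_lt h2
    rw [Complex.add_re, Complex.one_re] at h3
    nlinarith [abs_lt.1 h4, mul_self_nonneg (Complex.exp (L z / 2)).im]
  have hray : ∀ t : ℝ, 1 ≤ t → 2 < ‖(c + t * (z - c)) - c‖ := by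
    intro t ht
    rw [add_sub_cancel_left, norm_mul, Complex.norm_real, Real.norm_eq_abs, abs_of_pos (by linarith)]
    nlinarith
  set F : ℝ → ℝ := fun t => (Complex.exp (L (c + t * (z - c)) / 2)).re with hF
  have hFc : ContinuousOn F (Set.Ici 1) := by
    refine Complex.continuous_re.comp_continuousOn (Complex.continuous_exp.comp_continuousOn ?_)
    refine ContinuousOn.div_const (hL.comp (by fun_prop) fun t ht => ?_) _
    exact hray t ht
  have hlim : Tendsto F atTop (𝓝 1) := by
    have h1 : Tendsto (fun t : ℝ => c + t * (z - c)) atTop (Bornology.cobounded ℂ) := by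
      rw [← tendsto_norm_atTop_iff_cobounded]
      have h2 : Tendsto (fun t : ℝ => 2 * t - ‖c‖) atTop atTop :=
        tendsto_atTop_add_const_right _ _ (tendsto_id.const_mul_atTop two_pos)
      refine tendsto_atTop_mono' _ ?_ h2
      filter_upwards [eventually_ge_atTop (0 : ℝ)] with t ht
      have h3 := norm_sub_norm_le (t * (z - c)) (-c)
      rw [norm_mul, Complex.norm_real, Real.norm_eq_abs, abs_of_nonneg ht, norm_neg,
        sub_neg_eq_add, add_comm] at h3
      nlinarith
    have h4 : Tendsto (fun w => (Complex.exp (w / 2)).re) (𝓝 0) (𝓝 1) := by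
      have : Continuous fun w : ℂ => (Complex.exp (w / 2)).re := by fun_prop
      simpa using this.tendsto 0
    exact h4.comp (ht.comp h1)
  have hF1 : F 1 = (Complex.exp (L z / 2)).re := by simp [hF]
  rw [← hF1]
  by_contra! hneg
  obtain ⟨t, ht, ht1⟩ := ((hlim.eventually (lt_mem_nhds one_pos)).and (eventually_ge_atTop 1)).exists
  obtain ⟨u, hu, hu'⟩ := intermediate_value_Icc ht1 (hFc.mono Set.Icc_subset_Ici_self)
    (show (0 : ℝ) ∈ _ from ⟨hneg, ht.le⟩)
  exact hne _ (hray u hu.1) hu'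

/-- A uniform limit of polynomials on `K` that looks like `1 / (z - m)` away from a point `c` outside
`K`. -/
theorem exists_localKernel {K : Set ℂ} (hK : IsCompact K) (hc : IsConnected Kᶜ) {c : ℂ}
    (hcK : c ∉ K) :
    ∃ (m κ : ℂ) (g : ℂ → ℂ), PolyApprox K g ∧ ‖m - c‖ = 1 / 2 ∧ ‖κ‖ = 1 / 16 ∧
      ∀ z ∈ K, (z - m) * g z = 1 + κ * g z ^ 2 ∧ ‖g z‖ ≤ 200 / (1 + ‖z - c‖) := by
  obtain ⟨q, hq, L, hLc, he, ht, ha⟩ := exists_logRel hK hc hcK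
  have hcq : c - q ≠ 0 := norm_pos_iff.1 (by rw [hq]; exact one_pos)
  set m := (c + q) / 2 with hm
  set d := (c - q) / 2 with hd
  have hd0 : d ≠ 0 := div_ne_zero hcq two_ne_zero
  have hdn : ‖d‖ = 1 / 2 := by rw [hd, norm_div, hq]; simp
  set w : ℂ → ℂ := fun z => (z - c) * Complex.exp (L z / 2) with hw
  have hw2 : ∀ z, z ∈ K ∨ 2 < ‖z - c‖ → w z ^ 2 = (z - m) ^ 2 - d ^ 2 := by
    intro z hz
    simp only [hw]
    rw [mul_pow, ← Complex.exp_nat_mul, show ((2 : ℕ) : ℂ) * (L z / 2) = L z by push_cast; ring, sq,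
      mul_assoc, he z hz, hm, hd]
    ring
  have hwa : PolyApprox K w := by
    obtain ⟨M, hM, hLM⟩ := ha.exists_bound hK
    have h1 : PolyApprox K fun z => Complex.exp (L z / 2) := by
      refine PolyApprox.comp (φ := fun u => Complex.exp (u / 2)) hK
        (PolyApprox.of_differentiableOn (r := M) (R := M + 1) ?_ (by linarith)) ha
        fun z hz => by simpa using hLM z hz
      exact Differentiable.differentiableOn (by fun_prop)
    have h2 : PolyApprox K fun z => z - c := 
      (PolyApprox.polynomial K (X - C c)).congr fun z _ => by simp
    exact h2.mul hK h1
  have hZa : PolyApprox K fun z => z - m := 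
    (PolyApprox.polynomial K (X - C m)).congr fun z _ => by simp
  have hmc : ‖m - c‖ = 1 / 2 := by
    rw [show m - c = -d by rw [hm, hd]; ring, norm_neg, hdn]
  refine ⟨m, d ^ 2 / 4, fun z => 2 / d ^ 2 * ((z - m) - w z), (hZa.sub hK hwa).const_mul hK _,
    hmc, by rw [norm_div, norm_pow, hdn]; norm_num, fun z hz => ⟨?_, ?_⟩⟩
  · have h := hw2 z (.inl hz)
    field_simp
    linear_combination (-4) * h
  · have h := hw2 z (.inl hz)
    have hn : ‖2 / d ^ 2‖ = 8 := by rw [norm_div, norm_pow, hdn]; norm_num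
    rw [norm_mul, hn, le_div_iff₀ (by positivity)]
    rcases le_or_gt ‖z - c‖ 2 with hz2 | hz2
    · have h1 : ‖z - m‖ ≤ 5 / 2 := by
        have := norm_sub_le_norm_sub_add_norm_sub z c m
        rw [norm_sub_rev c m] at this
        linarith
      have h2 : ‖w z‖ ^ 2 ≤ ‖z - m‖ ^ 2 + ‖d‖ ^ 2 := by
        rw [← norm_pow, ← norm_pow, ← norm_pow, h]
        exact norm_sub_le _ _
      rw [hdn] at h2
      have h3 : ‖w z‖ ≤ 3 := by
        by_contra! h3
        nlinarith [norm_nonneg (z - m)]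
      have h4 := norm_sub_le (z - m) (w z)
      have h5 : ‖z - m - w z‖ ≤ 11 / 2 := by linarith
      have h6 : 0 ≤ ‖z - m - w z‖ := norm_nonneg _
      nlinarith [norm_nonneg (z - c)]
    · have hpos := LogRel.exp_half_re_pos hq hLc (fun z hz => he z (.inr hz)) ht hz2
      have hz0 : z - c ≠ 0 := norm_pos_iff.1 (by linarith)
      have h1 : (z - m) + w z = (z - c) * (1 + d / (z - c) + Complex.exp (L z / 2)) := by
        simp only [hw, hm, hd]
        field_simp
        ring
      have h2 : 3 / 4 ≤ ‖1 + d / (z - c) + Complex.exp (L z / 2)‖ := by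
        have h3 : ‖d / (z - c)‖ ≤ 1 / 4 := by
          rw [norm_div, hdn, div_le_iff₀ (by linarith)]
          linarith
        have h4 := abs_le.1 ((Complex.abs_re_le_norm _).trans h3)
        have h5 := Complex.re_le_norm (1 + d / (z - c) + Complex.exp (L z / 2))
        rw [Complex.add_re, Complex.add_re, Complex.one_re] at h5
        linarith
      have h3 : ‖z - m - w z‖ * ‖(z - m) + w z‖ = 1 / 4 := by
        rw [← norm_mul, show (z - m - w z) * ((z - m) + w z) = d ^ 2 by linear_combination -h,
          norm_pow, hdn]
        norm_num
      rw [h1, norm_mul] at h3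
      have h4 : ‖z - m - w z‖ * (‖z - c‖ * (3 / 4)) ≤ 1 / 4 := by
        rw [← h3]
        gcongr
      nlinarith [norm_nonneg (z - m - w z)]

theorem localKernel_error {c m κ z ζ g : ℂ} (hm : ‖m - c‖ = 1 / 2) (hκ : ‖κ‖ = 1 / 16)
    (hg : (z - m) * g = 1 + κ * g ^ 2) (hgb : ‖g‖ ≤ 200 / (1 + ‖z - c‖)) (hζ : ‖ζ - c‖ < 2)
    (hne : ζ ≠ z) :
    ‖g + (ζ - m) * g ^ 2 - (z - ζ)⁻¹‖ ≤ 14400000 * (‖z - ζ‖ * (1 + ‖z - ζ‖ ^ 2))⁻¹ := by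
  have h0 : z - ζ ≠ 0 := sub_ne_zero.2 hne.symm
  have hs : 0 < ‖z - ζ‖ := norm_pos_iff.2 h0
  have key : g + (ζ - m) * g ^ 2 - (z - ζ)⁻¹
      = (z - ζ)⁻¹ * ((κ - (ζ - m) ^ 2 + κ * (ζ - m) * g) * g ^ 2) := by
    field_simp
    linear_combination (1 + (ζ - m) * g) * hg
  have hξ : ‖ζ - m‖ ≤ 5 / 2 := by
    have := norm_sub_le_norm_sub_add_norm_sub ζ c m
    rw [norm_sub_rev c m] at this
    linarith
  have ht : (0 : ℝ) < 1 + ‖z - c‖ := by positivity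
  have hg200 : ‖g‖ ≤ 200 := hgb.trans (div_le_self (by norm_num) (by linarith [norm_nonneg (z - c)]))
  have h1 : ‖κ - (ζ - m) ^ 2 + κ * (ζ - m) * g‖ ≤ 40 := by
    refine (norm_add_le _ _).trans ?_
    have h2 := norm_sub_le κ ((ζ - m) ^ 2)
    rw [norm_pow, hκ] at h2
    have h3 : ‖κ * (ζ - m) * g‖ ≤ 1 / 16 * (5 / 2) * 200 := by
      rw [norm_mul, norm_mul, hκ]
      gcongr
    have h4 : ‖ζ - m‖ ^ 2 ≤ (5 / 2) ^ 2 := by gcongr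
    linarith
  have h2 : ‖g‖ ^ 2 ≤ 360000 * (1 + ‖z - ζ‖ ^ 2)⁻¹ := by
    have hle : ‖z - ζ‖ ≤ ‖z - c‖ + 2 := by
      have := norm_sub_le_norm_sub_add_norm_sub z c ζ
      rw [norm_sub_rev c ζ] at this
      linarith
    rw [← div_eq_mul_inv, le_div_iff₀ (by positivity)]
    have h3 : ‖g‖ * (1 + ‖z - c‖) ≤ 200 := (le_div_iff₀ ht).1 hgb
    have h4 : (‖g‖ * (1 + ‖z - c‖)) ^ 2 ≤ 200 ^ 2 := by gcongr
    have h5 : 1 + ‖z - ζ‖ ^ 2 ≤ 9 * (1 + ‖z - c‖) ^ 2 := by nlinarith [norm_nonneg (z - c)]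
    have h6 : ‖g‖ ^ 2 * (1 + ‖z - ζ‖ ^ 2) ≤ ‖g‖ ^ 2 * (9 * (1 + ‖z - c‖) ^ 2) := by gcongr
    nlinarith
  rw [key, norm_mul, norm_mul, norm_pow, norm_inv, mul_inv]
  calc ‖z - ζ‖⁻¹ * (‖κ - (ζ - m) ^ 2 + κ * (ζ - m) * g‖ * ‖g‖ ^ 2)
      ≤ ‖z - ζ‖⁻¹ * (40 * (360000 * (1 + ‖z - ζ‖ ^ 2)⁻¹)) := by gcongr
    _ = _ := by ring

section CauchyTransform

open MeasureTheory

theorem integrable_inv_norm_mul : Integrable fun ζ : ℂ => (‖ζ‖ * (1 + ‖ζ‖ ^ 2))⁻¹ := by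
  refine (integrable_fun_norm_addHaar (E := ℂ) volume
    (f := fun r : ℝ => (r * (1 + r ^ 2))⁻¹)).2 ?_
  refine (integrable_inv_one_add_sq.integrableOn (s := Set.Ioi 0)).congr_fun ?_ measurableSet_Ioi
  intro r hr
  have hr : r ≠ 0 := (Set.mem_Ioi.1 hr).ne'
  simp [Complex.finrank_real_complex]
  field_simp

theorem norm_inv_le_of_norm_le {ζ : ℂ} {R : ℝ} (h : ‖ζ‖ ≤ R) :
    ‖ζ⁻¹‖ ≤ (1 + R ^ 2) * (‖ζ‖ * (1 + ‖ζ‖ ^ 2))⁻¹ := by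
  rw [norm_inv, mul_inv, mul_left_comm]
  refine le_mul_of_one_le_right (by positivity) ?_
  rw [← div_eq_mul_inv, one_le_div (by positivity)]
  gcongr

theorem integrable_mul_inv_sub {u : ℂ → ℂ} (hu : AEStronglyMeasurable u) {M R : ℝ}
    (hM : ∀ ζ, ‖u ζ‖ ≤ M) (hR : ∀ ζ, R < ‖ζ‖ → u ζ = 0) (z : ℂ) :
    Integrable fun ζ => u ζ * (z - ζ)⁻¹ := by
  have hM0 : 0 ≤ M := (norm_nonneg _).trans (hM 0)
  have hE := ((integrable_inv_norm_mul.comp_sub_left z).const_mul (1 + (‖z‖ + R) ^ 2)).const_mul M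
  refine hE.mono' (hu.mul (by fun_prop)) (Eventually.of_forall fun ζ => ?_)
  rcases lt_or_ge R ‖ζ‖ with h | h
  · rw [hR ζ h, zero_mul, norm_zero]
    positivity
  · rw [norm_mul]
    gcongr
    · exact hM ζ
    · exact norm_inv_le_of_norm_le ((norm_sub_le _ _).trans (by gcongr))

theorem integral_closedBall_eq_circleIntegral {G : ℂ → ℂ} (hGm : Measurable G)
    (hG : Integrable ((closedBall (0 : ℂ) 1).indicator fun w => w * G w)) :
    ∫ w, (closedBall (0 : ℂ) 1).indicator (fun w => w * G w) w
      = ∫ r in Set.Ioc (0 : ℝ) 1, (r : ℂ) * (-Complex.I * ∮ w in C(0, r), G w) := by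
  set F := (closedBall (0 : ℂ) 1).indicator fun w => w * G w with hF
  have hint : IntegrableOn (fun p : ℝ × ℝ => p.1 • F (Complex.polarCoord.symm p))
      polarCoord.target := by
    have hmeas : Measurable fun p : ℝ × ℝ => p.1 • F (Complex.polarCoord.symm p) := by
      have hFm : Measurable F := (measurable_id.mul hGm).indicator measurableSet_closedBall
      refine measurable_fst.smul (hFm.comp ?_)
      rw [funext Complex.polarCoord_symm_apply]
      fun_prop
    refine ⟨hmeas.aestronglyMeasurable, ?_⟩
    have h := hG.hasFiniteIntegral
    rw [HasFiniteIntegral, ← Complex.lintegral_comp_polarCoord_symm] at h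
    refine lt_of_eq_of_lt ?_ h
    have hT : MeasurableSet polarCoord.target := by
      rw [polarCoord_target]
      measurability
    refine setLIntegral_congr_fun hT fun p hp => ?_
    have hp : 0 < p.1 := by
      rw [polarCoord_target] at hp
      exact hp.1
    simp only [enorm_smul, smul_eq_mul]
    rw [Real.enorm_of_nonneg hp.le]
  rw [← Complex.integral_comp_polarCoord_symm, polarCoord_target] at *
  rw [Measure.volume_eq_prod] at *
  rw [setIntegral_prod _ hint]
  rw [← integral_indicator measurableSet_Ioi, ← integral_indicator measurableSet_Ioc]
  congr 1
  ext r
  by_cases hr : r ∈ Set.Ioc (0 : ℝ) 1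
  · rw [Set.indicator_of_mem hr, Set.indicator_of_mem (Set.mem_Ioi.2 hr.1)]
    have h1 : ∫ θ in Set.Ioo (-Real.pi) Real.pi, r • F (Complex.polarCoord.symm (r, θ))
        = ∫ θ in (-Real.pi)..(-Real.pi + 2 * Real.pi),
          (r : ℂ) * (circleMap 0 r θ * G (circleMap 0 r θ)) := by
      rw [show -Real.pi + 2 * Real.pi = Real.pi by ring,
        intervalIntegral.integral_of_le (by linarith [Real.pi_pos]), integral_Ioc_eq_integral_Ioo]
      refine setIntegral_congr_fun measurableSet_Ioo fun θ _ => ?_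
      have h2 : Complex.polarCoord.symm (r, θ) = circleMap 0 r θ := by
        rw [Complex.polarCoord_symm_apply, circleMap, Complex.exp_mul_I]
        push_cast
        ring
      have h3 : circleMap 0 r θ ∈ closedBall (0 : ℂ) 1 := by
        simpa [abs_of_pos hr.1] using hr.2
      simp only [h2, hF, Set.indicator_of_mem h3, Complex.real_smul]
    have h2 : Function.Periodic (fun θ : ℝ => (r : ℂ) * (circleMap 0 r θ * G (circleMap 0 r θ)))
        (2 * Real.pi) := fun θ => by
      simp only [periodic_circleMap 0 r θ]
    rw [h1, h2.intervalIntegral_add_eq (-Real.pi) 0, zero_add, circleIntegral,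
      ← intervalIntegral.integral_const_mul, ← intervalIntegral.integral_const_mul]
    refine intervalIntegral.integral_congr fun θ _ => ?_
    simp only [deriv_circleMap, smul_eq_mul]
    linear_combination (r * (circleMap 0 r θ * G (circleMap 0 r θ)) : ℂ) * Complex.I_mul_I
  · rw [Set.indicator_of_notMem hr]
    refine Set.indicator_apply_eq_zero.2 fun h0 => ?_
    rw [Set.mem_Ioi] at h0
    have h1 : 1 < r := by
      by_contra! h
      exact hr ⟨h0, h⟩
    refine integral_eq_zero_of_ae (Eventually.of_forall fun θ => ?_)
    simp [hF, abs_of_pos h0, h1.not_ge]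

theorem integral_closedBall_mul_inv_sub (z : ℂ) :
    ∫ w, (closedBall (0 : ℂ) 1).indicator id w * (z - w)⁻¹
      = -(Real.pi * max 0 (1 - ‖z‖ ^ 2) : ℝ) := by
  have h : (fun w => (closedBall (0 : ℂ) 1).indicator id w * (z - w)⁻¹)
      = (closedBall (0 : ℂ) 1).indicator fun w => w * (z - w)⁻¹ := by
    ext w
    by_cases hw : w ∈ closedBall (0 : ℂ) 1 <;> simp [hw]
  have hint : Integrable fun w => (closedBall (0 : ℂ) 1).indicator id w * (z - w)⁻¹ := by
    refine integrable_mul_inv_sub (measurable_id.indicator measurableSet_closedBall).aestronglyMeasurable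
      (M := 1) (R := 1) (fun w => ?_) (fun w hw => ?_) z
    · by_cases hw : w ∈ closedBall (0 : ℂ) 1
      · simpa only [Set.indicator_of_mem hw, id, mem_closedBall, dist_zero_right] using hw
      · simp [Set.indicator_of_notMem hw]
    · simp [hw.not_ge]
  rw [h] at hint ⊢
  rw [integral_closedBall_eq_circleIntegral (by fun_prop) hint]
  have hin : ∀ r : ℝ, ‖z‖ < r → ∮ w in C(0, r), (z - w)⁻¹ = -(2 * Real.pi * Complex.I) := by
    intro r hr
    rw [← circleIntegral.integral_sub_inv_of_mem_ball (c := 0) (R := r) (w := z) (by simpa using hr),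
      circleIntegral, circleIntegral, ← intervalIntegral.integral_neg]
    congr 1
    ext w
    rw [← smul_neg, ← inv_neg, neg_sub]
  have hout : ∀ r : ℝ, 0 < r → r < ‖z‖ → ∮ w in C(0, r), (z - w)⁻¹ = 0 := by
    intro r h0 hr
    refine DiffContOnCl.circleIntegral_eq_zero h0.le (DifferentiableOn.diffContOnCl ?_)
    intro w hw
    have hw := closure_ball_subset_closedBall hw
    have hw : ‖w‖ ≤ r := by simpa using hw
    have hne : z - w ≠ 0 := sub_ne_zero.2 fun h => by
      rw [h] at hr
      linarith
    exact ((differentiableAt_id.const_sub z).inv hne).differentiableWithinAt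
  have hae : ∀ᵐ r : ℝ, r ≠ ‖z‖ := by simp [ae_iff]
  rcases le_or_gt 1 ‖z‖ with hz | hz
  · rw [max_eq_left (by nlinarith)]
    rw [setIntegral_congr_ae (g := fun _ => (0 : ℂ)) measurableSet_Ioc]
    · simp
    · filter_upwards [hae] with r hne hr
      rw [hout r hr.1 (lt_of_le_of_ne (hr.2.trans hz) hne)]
      simp
  · rw [max_eq_right (by nlinarith [norm_nonneg z]),
      setIntegral_congr_ae (g := (Set.Ioc ‖z‖ 1).indicator fun r : ℝ => (r : ℂ) * (-(2 * Real.pi)))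
        measurableSet_Ioc,
      setIntegral_indicator measurableSet_Ioc,
      Set.inter_eq_right.2 (Set.Ioc_subset_Ioc_left (norm_nonneg z)),
      ← intervalIntegral.integral_of_le hz.le, intervalIntegral.integral_mul_const,
      intervalIntegral.integral_ofReal, integral_id]
    · push_cast
      ring
    · filter_upwards [hae] with r hne hr
      rcases hne.lt_or_gt with h | h
      · rw [hout r hr.1 h, Set.indicator_of_notMem fun h' => h.not_gt h'.1]
        simp
      · rw [hin r h, Set.indicator_of_mem (Set.mem_Ioc.2 ⟨h, hr.2⟩)]
        linear_combination (2 * Real.pi * r : ℂ) * Complex.I_mul_I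

theorem integral_mul_closedBall_indicator_eq_zero {f : ℂ → ℂ} (hf : Continuous f) {ζ : ℂ}
    (hd : DifferentiableOn ℂ f (closedBall ζ 1)) :
    ∫ w, f (ζ - w) * (closedBall (0 : ℂ) 1).indicator id w = 0 := by
  have h : (fun w => f (ζ - w) * (closedBall (0 : ℂ) 1).indicator id w)
      = (closedBall (0 : ℂ) 1).indicator fun w => w * f (ζ - w) := by
    ext w
    by_cases hw : w ∈ closedBall (0 : ℂ) 1 <;> simp [hw, mul_comm]
  have hint : Integrable ((closedBall (0 : ℂ) 1).indicator fun w => w * f (ζ - w)) :=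
    ((by fun_prop : Continuous fun w => w * f (ζ - w)).continuousOn.integrableOn_compact
      (isCompact_closedBall 0 1)).integrable_indicator measurableSet_closedBall
  rw [h, integral_closedBall_eq_circleIntegral (by fun_prop) hint]
  refine integral_eq_zero_of_ae ((ae_restrict_iff' measurableSet_Ioc).2 (.of_forall fun r hr => ?_))
  have h0 : ∮ w in C(0, r), f (ζ - w) = 0 := by
    refine DiffContOnCl.circleIntegral_eq_zero hr.1.le (DifferentiableOn.diffContOnCl ?_)
    refine hd.comp (by fun_prop) fun w hw => ?_
    have hw := closure_ball_subset_closedBall hw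
    have hw : ‖w‖ ≤ r := by simpa using hw
    simpa [dist_eq_norm] using hw.trans hr.2
  simp [h0]

theorem integral_closedBall_indicator_id :
    ∫ w, (closedBall (0 : ℂ) 1).indicator id w = 0 := by
  simpa using integral_mul_closedBall_indicator_eq_zero (f := fun _ => 1) continuous_const (ζ := 0)
    (differentiableOn_const _)

end CauchyTransform

section SmoothedCauchy

open MeasureTheory

theorem exists_measurable_weights {ι : Type*} (s : Finset ι) {U : ι → Set ℂ}
    (hU : ∀ i, MeasurableSet (U i)) :
    ∃ χ : ι → ℂ → ℝ, (∀ i, Measurable (χ i)) ∧ (∀ i x, 0 ≤ χ i x) ∧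
      (∀ i x, x ∉ U i → χ i x = 0) ∧ ∀ x, (∃ i ∈ s, x ∈ U i) → ∑ i ∈ s, χ i x = 1 := by
  refine ⟨fun i x => (U i).indicator 1 x / ∑ j ∈ s, (U j).indicator 1 x, fun i => ?_,
    fun i x => ?_, fun i x hx => by simp [hx], ?_⟩
  · have h : ∀ i, Measurable ((U i).indicator (1 : ℂ → ℝ)) := fun i =>
      measurable_one.indicator (hU i)
    exact (h i).div (Finset.measurable_sum s fun j _ => h j)
  · exact div_nonneg (Set.indicator_nonneg (fun _ _ => zero_le_one) _)
      (Finset.sum_nonneg fun j _ => Set.indicator_nonneg (fun _ _ => zero_le_one) _)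
  · rintro x ⟨i, hi, hx⟩
    rw [← Finset.sum_div]
    refine div_self (ne_of_gt ?_)
    refine lt_of_lt_of_le (by simp [hx] : 0 < (U i).indicator (1 : ℂ → ℝ) x) ?_
    exact Finset.single_le_sum (f := fun j => (U j).indicator (1 : ℂ → ℝ) x)
      (fun j _ => Set.indicator_nonneg (fun _ _ => zero_le_one) _) hi

theorem norm_closedBall_indicator_id_le (w : ℂ) :
    ‖(closedBall (0 : ℂ) 1).indicator id w‖ ≤ (closedBall (0 : ℂ) 1).indicator 1 w := by
  by_cases hw : w ∈ closedBall (0 : ℂ) 1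
  · simpa only [Set.indicator_of_mem hw, id, mem_closedBall, dist_zero_right, Pi.one_apply] using hw
  · simp [Set.indicator_of_notMem hw]

theorem measurable_closedBall_indicator_id : Measurable ((closedBall (0 : ℂ) 1).indicator id) :=
  measurable_id.indicator measurableSet_closedBall

theorem integrable_closedBall_indicator_one :
    Integrable ((closedBall (0 : ℂ) 1).indicator (1 : ℂ → ℝ)) :=
  (continuousOn_const.integrableOn_compact (isCompact_closedBall 0 1)).integrable_indicator
    measurableSet_closedBall

theorem integrable_closedBall_indicator_id :
    Integrable ((closedBall (0 : ℂ) 1).indicator id) :=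
  integrable_closedBall_indicator_one.mono' measurable_closedBall_indicator_id.aestronglyMeasurable
    (.of_forall norm_closedBall_indicator_id_le)

/-- Density of a smoothed `f` with respect to the Cauchy kernel. -/
def cauchyDensity (f : ℂ → ℂ) (ζ : ℂ) : ℂ :=
  ∫ w, f (ζ - w) * (closedBall (0 : ℂ) 1).indicator id w

theorem cauchyDensity_eq (f : ℂ → ℂ) (ζ : ℂ) :
    cauchyDensity f ζ = ∫ s, f s * (closedBall (0 : ℂ) 1).indicator id (ζ - s) := by
  rw [cauchyDensity, ← integral_sub_left_eq_self _ volume ζ]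
  simp

theorem norm_cauchyDensity_le {f : ℂ → ℂ} (hf : Continuous f) {ω : ℝ}
    (hω : ∀ z w, ‖z - w‖ ≤ 1 → ‖f z - f w‖ ≤ ω) (ζ : ℂ) :
    ‖cauchyDensity f ζ‖ ≤ ω * ∫ w, (closedBall (0 : ℂ) 1).indicator (1 : ℂ → ℝ) w := by
  have h1 : Integrable fun w => f (ζ - w) * (closedBall (0 : ℂ) 1).indicator id w := by
    have : (fun w => f (ζ - w) * (closedBall (0 : ℂ) 1).indicator id w)
        = (closedBall (0 : ℂ) 1).indicator fun w => f (ζ - w) * w := by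
      ext w
      by_cases hw : w ∈ closedBall (0 : ℂ) 1 <;> simp [hw]
    rw [this]
    exact ((by fun_prop : Continuous fun w => f (ζ - w) * w).continuousOn.integrableOn_compact
      (isCompact_closedBall 0 1)).integrable_indicator measurableSet_closedBall
  have h2 := integrable_closedBall_indicator_id.const_mul (f ζ)
  have h3 : cauchyDensity f ζ
      = ∫ w, (f (ζ - w) - f ζ) * (closedBall (0 : ℂ) 1).indicator id w := by
    simp_rw [sub_mul]
    rw [integral_sub h1 h2, integral_const_mul, integral_closedBall_indicator_id, mul_zero, sub_zero,
      cauchyDensity]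
  rw [h3, ← integral_const_mul]
  refine norm_integral_le_of_norm_le (integrable_closedBall_indicator_one.const_mul ω)
    (.of_forall fun w => ?_)
  rw [norm_mul]
  have hω0 : 0 ≤ ω := (norm_nonneg _).trans (hω 0 0 (by simp))
  by_cases hw : w ∈ closedBall (0 : ℂ) 1
  · exact mul_le_mul (hω _ _ (by simpa using hw)) (norm_closedBall_indicator_id_le w)
      (norm_nonneg _) hω0
  · simp [hw]

theorem aestronglyMeasurable_cauchyDensity {f : ℂ → ℂ} (hf : Continuous f) :
    AEStronglyMeasurable (cauchyDensity f) := by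
  have h : Measurable fun p : ℂ × ℂ => f (p.1 - p.2) * (closedBall (0 : ℂ) 1).indicator id p.2 :=
    (hf.measurable.comp (measurable_fst.sub measurable_snd)).mul
      (measurable_closedBall_indicator_id.comp measurable_snd)
  exact (h.stronglyMeasurable.integral_prod_right (ν := volume)).aestronglyMeasurable

theorem cauchyDensity_eq_zero {f : ℂ → ℂ} {R : ℝ} (hR : ∀ z, R < ‖z‖ → f z = 0) {ζ : ℂ}
    (hζ : R + 1 < ‖ζ‖) : cauchyDensity f ζ = 0 := by
  refine integral_eq_zero_of_ae (.of_forall fun w => ?_)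
  by_cases hw : w ∈ closedBall (0 : ℂ) 1
  · have hw' : ‖w‖ ≤ 1 := by simpa using hw
    have := norm_sub_norm_le ζ w
    simp [hR (ζ - w) (by linarith)]
  · simp [hw]

theorem integral_cauchyDensity_mul_inv_sub {f : ℂ → ℂ} (hf : Continuous f) {R : ℝ}
    (hR : ∀ z, R < ‖z‖ → f z = 0) (z : ℂ) :
    ∫ ζ, cauchyDensity f ζ * (z - ζ)⁻¹
      = ∫ s, f s * -(Real.pi * max 0 (1 - ‖z - s‖ ^ 2) : ℝ) := by
  obtain ⟨M, hM⟩ : ∃ M, ∀ s, ‖f s‖ ≤ M := by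
    refine (hf.bounded_above_of_compact_support ?_)
    refine HasCompactSupport.intro (isCompact_closedBall 0 R) fun x hx => hR x ?_
    simpa using hx
  have hfi : Integrable f := by
    refine hf.integrable_of_hasCompactSupport ?_
    refine HasCompactSupport.intro (isCompact_closedBall 0 R) fun x hx => hR x ?_
    simpa using hx
  have hint : Integrable (Function.uncurry fun ζ s =>
      f s * (closedBall (0 : ℂ) 1).indicator id (ζ - s) * (z - ζ)⁻¹) (volume.prod volume) := by
    have h1 : Integrable fun ζ => (closedBall (0 : ℂ) (R + 1)).indicator 1 ζ * (z - ζ)⁻¹ := by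
      refine integrable_mul_inv_sub (M := 1) (R := R + 1)
        (measurable_one.indicator measurableSet_closedBall).aestronglyMeasurable
        (fun ζ => ?_) (fun ζ h => ?_) z
      · by_cases h : ζ ∈ closedBall (0 : ℂ) (R + 1) <;> simp [h]
      · simp [h]
    refine (h1.mul_prod hfi).mono ?_ (.of_forall ?_)
    · refine Measurable.aestronglyMeasurable ?_
      refine Measurable.mul (Measurable.mul (hf.measurable.comp measurable_snd)
        (measurable_closedBall_indicator_id.comp (measurable_fst.sub measurable_snd))) ?_
      fun_prop
    · rintro ⟨ζ, s⟩
      simp only [Function.uncurry_apply_pair, norm_mul]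
      rcases lt_or_ge R ‖s‖ with hs | hs
      · simp [hR s hs]
      by_cases h : ζ - s ∈ closedBall (0 : ℂ) 1
      · have h' : ‖ζ - s‖ ≤ 1 := by simpa using h
        have h2 : ζ ∈ closedBall (0 : ℂ) (R + 1) := by
          have := norm_sub_norm_le ζ s
          rw [mem_closedBall_zero_iff]
          linarith
        have h3 : ‖(closedBall (0 : ℂ) 1).indicator id (ζ - s)‖ ≤ 1 := by
          simpa [h] using norm_closedBall_indicator_id_le (ζ - s)
        rw [Set.indicator_of_mem h2, Pi.one_apply, norm_one, one_mul, mul_comm ‖(z - ζ)⁻¹‖]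
        gcongr
        exact mul_le_of_le_one_right (norm_nonneg _) h3
      · rw [Set.indicator_of_notMem h, norm_zero, mul_zero, zero_mul]
        positivity
  simp_rw [cauchyDensity_eq, ← integral_mul_const]
  rw [integral_integral_swap hint]
  congr 1
  ext s
  simp_rw [mul_assoc]
  rw [integral_const_mul, ← integral_add_right_eq_self _ s]
  simp_rw [add_sub_cancel_right, sub_add_eq_sub_sub_swap]
  rw [integral_closedBall_mul_inv_sub]

theorem integrable_bump (z : ℂ) :
    Integrable fun s : ℂ => Real.pi * max 0 (1 - ‖z - s‖ ^ 2) := by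
  refine Continuous.integrable_of_hasCompactSupport (by fun_prop) ?_
  refine HasCompactSupport.intro (isCompact_closedBall z 1) fun x hx => ?_
  rw [mem_closedBall, dist_eq_norm, norm_sub_rev, not_le] at hx
  rw [max_eq_left (by nlinarith), mul_zero]

theorem integral_bump_pos : 0 < ∫ s : ℂ, Real.pi * max 0 (1 - ‖s‖ ^ 2) := by
  have h := integrable_bump 0
  simp only [zero_sub, norm_neg] at h
  refine Continuous.integral_pos_of_hasCompactSupport_nonneg_nonzero (x := 0) (by fun_prop) ?_ ?_ ?_
  · refine HasCompactSupport.intro (isCompact_closedBall 0 1) fun x hx => ?_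
    rw [mem_closedBall, dist_zero_right, not_le] at hx
    rw [max_eq_left (by nlinarith), mul_zero]
  · intro s
    have := Real.pi_pos
    positivity
  · simp [Real.pi_ne_zero]

theorem norm_integral_cauchyDensity_add_le {f : ℂ → ℂ} (hf : Continuous f) {R : ℝ}
    (hR : ∀ z, R < ‖z‖ → f z = 0) {ω : ℝ} (hω : ∀ z w, ‖z - w‖ ≤ 1 → ‖f z - f w‖ ≤ ω) (z : ℂ) :
    ‖(∫ ζ, cauchyDensity f ζ * (z - ζ)⁻¹)
        + (∫ s : ℂ, Real.pi * max 0 (1 - ‖s‖ ^ 2) : ℝ) * f z‖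
      ≤ ω * ∫ s : ℂ, Real.pi * max 0 (1 - ‖s‖ ^ 2) := by
  have hω0 : 0 ≤ ω := (norm_nonneg _).trans (hω 0 0 (by simp))
  have hJ : ∫ s : ℂ, Real.pi * max 0 (1 - ‖s‖ ^ 2)
      = ∫ s : ℂ, Real.pi * max 0 (1 - ‖z - s‖ ^ 2) :=
    (integral_sub_left_eq_self (fun s : ℂ => Real.pi * max 0 (1 - ‖s‖ ^ 2)) volume z).symm
  rw [integral_cauchyDensity_mul_inv_sub hf hR, hJ, ← integral_complex_ofReal,
    ← integral_mul_const, ← integral_const_mul, ← integral_add]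
  · refine norm_integral_le_of_norm_le ((integrable_bump z).const_mul ω) (.of_forall fun s => ?_)
    rw [show f s * -((Real.pi * max 0 (1 - ‖z - s‖ ^ 2) : ℝ) : ℂ)
        + ((Real.pi * max 0 (1 - ‖z - s‖ ^ 2) : ℝ) : ℂ) * f z
        = (f z - f s) * ((Real.pi * max 0 (1 - ‖z - s‖ ^ 2) : ℝ) : ℂ) by ring, norm_mul,
      Complex.norm_real, Real.norm_of_nonneg (by have := Real.pi_pos; positivity)]
    rcases le_or_gt ‖z - s‖ 1 with h | h
    · have := Real.pi_pos
      gcongr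
      exact hω z s h
    · rw [max_eq_left (by nlinarith)]
      simp
  · refine Continuous.integrable_of_hasCompactSupport (by fun_prop) ?_
    refine HasCompactSupport.intro (isCompact_closedBall 0 R) fun x hx => ?_
    rw [hR x (by simpa using hx), zero_mul]
  · exact (integrable_bump z).ofReal.mul_const _

end SmoothedCauchy

section Oscillation

open MeasureTheory

theorem exists_notMem_of_cauchyDensity_ne_zero {K : Set ℂ} {f : ℂ → ℂ} (hf : Continuous f)
    (hd : DifferentiableOn ℂ f (interior K)) {ζ : ℂ} (h : cauchyDensity f ζ ≠ 0) :
    ∃ c ∉ K, ‖ζ - c‖ < 3 / 2 := by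
  have hsub : ¬closedBall ζ 1 ⊆ interior K := fun hs =>
    h (integral_mul_closedBall_indicator_eq_zero hf (hd.mono hs))
  obtain ⟨x, hx, hxK⟩ := Set.not_subset.1 hsub
  rw [← Set.mem_compl_iff, ← closure_compl] at hxK
  obtain ⟨c, hc, hxc⟩ := Metric.mem_closure_iff.1 hxK (1 / 2) (by norm_num)
  refine ⟨c, hc, ?_⟩
  rw [dist_eq_norm] at hxc
  rw [mem_closedBall, dist_comm, dist_eq_norm] at hx
  have := norm_sub_le_norm_sub_add_norm_sub ζ x c
  linarith

theorem exists_polyApprox_of_oscillation {K : Set ℂ} (hK : IsCompact K) (hc : IsConnected Kᶜ)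
    {f : ℂ → ℂ} (hf : Continuous f) (hfs : HasCompactSupport f)
    (hd : DifferentiableOn ℂ f (interior K)) {ω : ℝ}
    (hω : ∀ z w, ‖z - w‖ ≤ 1 → ‖f z - f w‖ ≤ ω) :
    ∃ F, PolyApprox K F ∧ ∀ z ∈ K, ‖F z - f z‖ ≤
      (1 + 14400000 * (∫ w, (closedBall (0 : ℂ) 1).indicator (1 : ℂ → ℝ) w)
        * (∫ ζ : ℂ, (‖ζ‖ * (1 + ‖ζ‖ ^ 2))⁻¹) / ∫ s : ℂ, Real.pi * max 0 (1 - ‖s‖ ^ 2)) * ω := by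
  set u := cauchyDensity f with hu
  set V := ∫ w, (closedBall (0 : ℂ) 1).indicator (1 : ℂ → ℝ) w with hV
  set E := ∫ ζ : ℂ, (‖ζ‖ * (1 + ‖ζ‖ ^ 2))⁻¹ with hE
  set J := ∫ s : ℂ, Real.pi * max 0 (1 - ‖s‖ ^ 2) with hJ
  have hJ0 : 0 < J := integral_bump_pos
  obtain ⟨R, hR⟩ : ∃ R, ∀ z, R < ‖z‖ → f z = 0 := by
    obtain ⟨R, hR⟩ := hfs.isCompact.isBounded.subset_closedBall 0
    refine ⟨R, fun z hz => ?_⟩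
    by_contra h
    have := hR (subset_tsupport f h)
    rw [mem_closedBall_zero_iff] at this
    linarith
  have huM : ∀ ζ, ‖u ζ‖ ≤ ω * V := norm_cauchyDensity_le hf hω
  have huR : ∀ ζ, R + 1 < ‖ζ‖ → u ζ = 0 := fun ζ => cauchyDensity_eq_zero hR
  have hum : AEStronglyMeasurable u := aestronglyMeasurable_cauchyDensity hf
  have htb : TotallyBounded {ζ | u ζ ≠ 0} := by
    refine ((isCompact_closedBall (0 : ℂ) (R + 1)).totallyBounded).subset fun ζ hζ => ?_
    rw [mem_closedBall_zero_iff]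
    by_contra! h
    exact hζ (huR ζ h)
  obtain ⟨t, ht, htf, hcov⟩ := Metric.finite_approx_of_totallyBounded htb (1 / 2) (by norm_num)
  have hex : ∀ ζ : t, ∃ c ∉ K, ‖(ζ : ℂ) - c‖ < 3 / 2 := fun ζ =>
    exists_notMem_of_cauchyDensity_ne_zero hf hd (ht ζ.2)
  choose c hcK hcζ using hex
  have : Fintype t := htf.fintype
  choose m κ g hg hm hκ hgz using fun i => exists_localKernel hK hc (hcK i)
  obtain ⟨χ, hχm, hχ0, hχU, hχ1⟩ := exists_measurable_weights (Finset.univ : Finset t)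
    (U := fun i => ball (c i) 2) fun i => measurableSet_ball
  have hsum : ∀ ζ, u ζ ≠ 0 → ∑ i, χ i ζ = 1 := by
    intro ζ hζ
    obtain ⟨y, hy, hζy⟩ := Set.mem_iUnion₂.1 (hcov hζ)
    refine hχ1 ζ ⟨⟨y, hy⟩, Finset.mem_univ _, ?_⟩
    rw [mem_ball, dist_eq_norm] at hζy ⊢
    have := norm_sub_le_norm_sub_add_norm_sub ζ y (c ⟨y, hy⟩)
    linarith [hcζ ⟨y, hy⟩]
  have hvm : ∀ i, AEStronglyMeasurable fun ζ => u ζ * (χ i ζ : ℂ) := fun i =>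
    hum.mul (Complex.measurable_ofReal.comp (hχm i)).aestronglyMeasurable
  have hvM : ∀ i ζ, ‖u ζ * (χ i ζ : ℂ)‖ ≤ ω * V := by
    intro i ζ
    by_cases hζ : u ζ = 0
    · rw [hζ, zero_mul, norm_zero]
      exact (norm_nonneg _).trans (huM 0)
    · rw [norm_mul, Complex.norm_real, Real.norm_of_nonneg (hχ0 i ζ)]
      refine (mul_le_of_le_one_right (norm_nonneg _) ?_).trans (huM ζ)
      rw [← hsum ζ hζ]
      exact Finset.single_le_sum (fun j _ => hχ0 j ζ) (Finset.mem_univ i)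
  have hvR : ∀ i ζ, R + 1 < ‖ζ‖ → u ζ * (χ i ζ : ℂ) = 0 := fun i ζ h => by rw [huR ζ h, zero_mul]
  have hvi : ∀ i, ∀ φ : ℂ → ℂ, Continuous φ → Integrable fun ζ => u ζ * (χ i ζ : ℂ) * φ ζ := by
    intro i φ hφ
    have h1 := hφ.continuousOn.integrableOn_compact (μ := volume) (isCompact_closedBall (0 : ℂ) (R + 1))
    have h2 := (h1.integrable_indicator measurableSet_closedBall).bdd_mul (hvm i) (.of_forall (hvM i))
    refine h2.congr (.of_forall fun ζ => ?_)
    by_cases h : ζ ∈ closedBall (0 : ℂ) (R + 1)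
    · simp only [Set.indicator_of_mem h]
    · rw [mem_closedBall_zero_iff, not_le] at h
      simp [huR ζ h]
  have hvz : ∀ i z, Integrable fun ζ => u ζ * (χ i ζ : ℂ) * (z - ζ)⁻¹ := fun i z =>
    integrable_mul_inv_sub (hvm i) (hvM i) (hvR i) z
  set G : ℂ → ℂ := fun z => ∑ i, ((∫ ζ, u ζ * (χ i ζ : ℂ)) * g i z
    + (∫ ζ, u ζ * (χ i ζ : ℂ) * (ζ - m i)) * g i z ^ 2) with hG
  have hGa : PolyApprox K G :=
    PolyApprox.sum _ fun i _ => ((hg i).const_mul hK _).add (((hg i).pow hK 2).const_mul hK _)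
  have hGK : ∀ z ∈ K, ‖G z - ∫ ζ, u ζ * (z - ζ)⁻¹‖ ≤ ω * V * 14400000 * E := by
    intro z hz
    have hterm : ∀ i, Integrable fun ζ => u ζ * (χ i ζ : ℂ) *
        (g i z + (ζ - m i) * g i z ^ 2 - (z - ζ)⁻¹) := by
      intro i
      simp_rw [mul_sub (u _ * (χ i _ : ℂ))]
      exact (hvi i _ (by fun_prop)).sub (hvz i z)
    have h1 : G z - ∫ ζ, u ζ * (z - ζ)⁻¹ = ∫ ζ, ∑ i, u ζ * (χ i ζ : ℂ) *
        (g i z + (ζ - m i) * g i z ^ 2 - (z - ζ)⁻¹) := by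
      have h2 : ∀ ζ, u ζ * (z - ζ)⁻¹ = ∑ i, u ζ * (χ i ζ : ℂ) * (z - ζ)⁻¹ := by
        intro ζ
        by_cases hζ : u ζ = 0
        · simp [hζ]
        · rw [← Finset.sum_mul, ← Finset.mul_sum, ← Complex.ofReal_sum, hsum ζ hζ, Complex.ofReal_one,
            mul_one]
      simp_rw [h2]
      rw [integral_finsetSum _ fun i _ => hterm i, integral_finsetSum _ fun i _ => hvz i z, hG,
        ← Finset.sum_sub_distrib]
      refine Finset.sum_congr rfl fun i _ => ?_
      rw [← integral_mul_const, ← integral_mul_const, ← integral_add, ← integral_sub]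
      · congr 1
        ext ζ
        ring
      · exact ((hvi i (fun _ => g i z) (by fun_prop))).add
          ((hvi i (fun ζ => ζ - m i) (by fun_prop)).mul_const _)
      · exact hvz i z
      · exact hvi i (fun _ => g i z) (by fun_prop)
      · exact (hvi i (fun ζ => ζ - m i) (by fun_prop)).mul_const _
    have hEz : E = ∫ ζ : ℂ, (‖z - ζ‖ * (1 + ‖z - ζ‖ ^ 2))⁻¹ :=
      (integral_sub_left_eq_self (fun ζ : ℂ => (‖ζ‖ * (1 + ‖ζ‖ ^ 2))⁻¹) volume z).symm
    rw [h1, hEz, ← integral_const_mul]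
    refine norm_integral_le_of_norm_le ((integrable_inv_norm_mul.comp_sub_left z).const_mul _) ?_
    have hne : ∀ᵐ ζ : ℂ, ζ ≠ z := by simp [ae_iff]
    filter_upwards [hne] with ζ hζz
    refine (norm_sum_le _ _).trans ?_
    have h3 : ∀ i, ‖u ζ * (χ i ζ : ℂ) * (g i z + (ζ - m i) * g i z ^ 2 - (z - ζ)⁻¹)‖
        ≤ ‖u ζ‖ * (14400000 * (‖z - ζ‖ * (1 + ‖z - ζ‖ ^ 2))⁻¹) * χ i ζ := by
      intro i
      rw [norm_mul, norm_mul, Complex.norm_real, Real.norm_of_nonneg (hχ0 i ζ)]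
      by_cases hζ : ζ ∈ ball (c i) 2
      · have h4 := localKernel_error (hm i) (hκ i) (hgz i z hz).1 (hgz i z hz).2
          (by simpa [dist_eq_norm] using hζ) hζz
        have := hχ0 i ζ
        calc ‖u ζ‖ * χ i ζ * ‖g i z + (ζ - m i) * g i z ^ 2 - (z - ζ)⁻¹‖
            ≤ ‖u ζ‖ * χ i ζ * (14400000 * (‖z - ζ‖ * (1 + ‖z - ζ‖ ^ 2))⁻¹) := by gcongr
          _ = _ := by ring
      · simp [hχU i ζ hζ]
    refine (Finset.sum_le_sum fun i _ => h3 i).trans ?_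
    rw [← Finset.mul_sum]
    by_cases hζ : u ζ = 0
    · rw [hζ]
      have := (norm_nonneg _).trans (huM 0)
      simp only [norm_zero, zero_mul]
      positivity
    · rw [hsum ζ hζ, mul_one, mul_assoc (ω * V)]
      gcongr
      exact huM ζ
  have hJc : (J : ℂ) ≠ 0 := Complex.ofReal_ne_zero.2 hJ0.ne'
  refine ⟨fun z => -(J : ℂ)⁻¹ * G z, hGa.const_mul hK _, fun z hz => ?_⟩
  have h1 := norm_integral_cauchyDensity_add_le hf hR hω z
  have h2 := hGK z hz
  rw [← hu, ← hJ] at h1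
  have h3 : -(J : ℂ)⁻¹ * G z - f z = -(J : ℂ)⁻¹ * ((G z - ∫ ζ, u ζ * (z - ζ)⁻¹)
      + ((∫ ζ, u ζ * (z - ζ)⁻¹) + J * f z)) := by
    field_simp
    ring
  rw [h3, norm_mul, norm_neg, norm_inv, Complex.norm_real, Real.norm_of_nonneg hJ0.le,
    inv_mul_le_iff₀ hJ0]
  refine (norm_add_le _ _).trans ((add_le_add h2 h1).trans (le_of_eq ?_))
  field_simp
  ring

end Oscillation

theorem exists_continuous_hasCompactSupport_extension {K : Set ℂ} (hK : IsCompact K) {h : ℂ → ℂ}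
    (hh : ContinuousOn h K) :
    ∃ f : ℂ → ℂ, Continuous f ∧ HasCompactSupport f ∧ ∀ z ∈ K, f z = h z := by
  obtain ⟨g, hg⟩ := ContinuousMap.exists_restrict_eq hK.isClosed ⟨K.domRestrict h, hh.domRestrict⟩
  obtain ⟨R, hR⟩ := hK.isBounded.subset_closedBall 0
  refine ⟨fun z => (max 0 (min 1 (R + 1 - ‖z‖)) : ℝ) * g z, by fun_prop, ?_, fun z hz => ?_⟩
  · refine HasCompactSupport.intro (isCompact_closedBall 0 (R + 1)) fun x hx => ?_
    rw [mem_closedBall_zero_iff, not_le] at hx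
    rw [max_eq_left (min_le_of_right_le (by linarith)), Complex.ofReal_zero, zero_mul]
  · have h1 := hR hz
    rw [mem_closedBall_zero_iff] at h1
    have h2 := DFunLike.congr_fun hg ⟨z, hz⟩
    beta_reduce
    rw [min_eq_left (by linarith), max_eq_right zero_le_one, Complex.ofReal_one, one_mul]
    exact h2

/-- Mergelyan's theorem. -/
theorem PolyApprox.of_continuousOn {K : Set ℂ} (hK : IsCompact K) (hc : IsConnected Kᶜ) {h : ℂ → ℂ}
    (hh : ContinuousOn h K) (hd : DifferentiableOn ℂ h (interior K)) : PolyApprox K h := by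
  obtain ⟨f, hf, hfs, hfh⟩ := exists_continuous_hasCompactSupport_extension hK hh
  suffices PolyApprox K f from this.congr hfh
  have hfd : DifferentiableOn ℂ f (interior K) := hd.congr fun z hz => hfh z (interior_subset hz)
  obtain ⟨A, hA⟩ : ∃ A : ℝ, ∀ {K : Set ℂ} (_ : IsCompact K) (_ : IsConnected Kᶜ) {f : ℂ → ℂ}
      (_ : Continuous f) (_ : HasCompactSupport f) (_ : DifferentiableOn ℂ f (interior K)) {ω : ℝ}
      (_ : ∀ z w, ‖z - w‖ ≤ 1 → ‖f z - f w‖ ≤ ω),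
      ∃ F, PolyApprox K F ∧ ∀ z ∈ K, ‖F z - f z‖ ≤ A * ω :=
    ⟨_, exists_polyApprox_of_oscillation⟩
  intro ε hε
  obtain ⟨δ, hδ, hδf⟩ := Metric.uniformContinuous_iff.1
    (hfs.uniformContinuous_of_continuous hf) (ε / 2 / (|A| + 1)) (by positivity)
  have hδ0 : ((δ / 2 : ℝ) : ℂ) ≠ 0 := Complex.ofReal_ne_zero.2 (by positivity)
  set e : ℂ ≃ₜ ℂ := Homeomorph.mulLeft₀ ((δ / 2 : ℝ) : ℂ) hδ0 with he
  have he' : ∀ z, e z = ((δ / 2 : ℝ) : ℂ) * z := fun z => rfl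
  have hes : ∀ z, e.symm z = ((δ / 2 : ℝ) : ℂ)⁻¹ * z := fun z => rfl
  obtain ⟨F, hF, hFf⟩ := hA (K := e ⁻¹' K) (e.isCompact_preimage.2 hK)
    (by rwa [← Set.preimage_compl, e.isConnected_preimage]) (hf.comp e.continuous)
    (hfs.comp_homeomorph e) (ω := ε / 2 / (|A| + 1))
    (by
      rw [← e.preimage_interior]
      exact hfd.comp (by simp only [funext he']; fun_prop) fun z hz => hz)
    (fun z w hzw => by
      rw [← dist_eq_norm]
      refine (hδf ?_).le
      rw [he', he', dist_eq_norm, ← mul_sub, norm_mul, Complex.norm_real,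
        Real.norm_of_nonneg (by positivity)]
      nlinarith)
  obtain ⟨p, hp⟩ := hF (ε / 2) (by positivity)
  refine ⟨p.comp (C ((δ / 2 : ℝ) : ℂ)⁻¹ * X), fun z hz => ?_⟩
  have h1 : e (e.symm z) = z := e.apply_symm_apply z
  have h2 : e.symm z ∈ e ⁻¹' K := by rwa [Set.mem_preimage, h1]
  have h3 := hp _ h2
  have h4 := hFf _ h2
  rw [Function.comp_apply, h1] at h4
  have h5 : A * (ε / 2 / (|A| + 1)) ≤ ε / 2 := by
    rw [mul_div_assoc', div_le_iff₀ (by positivity)]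
    nlinarith [le_abs_self A]
  rw [eval_comp, eval_mul, eval_C, eval_X, ← hes]
  have := norm_sub_le_norm_sub_add_norm_sub (p.eval (e.symm z)) (F (e.symm z)) (f z)
  linarith

theorem isPreconnected_setOf_norm_mem {S : Set ℝ} (hS : IsPreconnected S) (h0 : S ⊆ Set.Ici 0) :
    IsPreconnected {z : ℂ | ‖z‖ ∈ S} := by
  have h := (hS.prod isPreconnected_univ).image
    (fun p : ℝ × ℝ => (p.1 : ℂ) * Complex.exp (p.2 * Complex.I)) (by fun_prop)
  convert h using 1
  ext z
  constructor
  · intro hz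
    exact ⟨(‖z‖, z.arg), ⟨hz, trivial⟩, Complex.norm_mul_exp_arg_mul_I z⟩
  · rintro ⟨⟨t, θ⟩, ⟨ht, -⟩, rfl⟩
    simpa [Complex.norm_exp_ofReal_mul_I, abs_of_nonneg (Set.mem_Ici.1 (h0 ht))] using ht

theorem isConnected_compl_union_closedBall {K : Set ℂ} (hK : IsCompact K) (hc : IsConnected Kᶜ)
    (hd : Disjoint K (ball 0 1)) {r : ℝ} (h0 : 0 ≤ r) (h1 : r < 1) :
    IsConnected (K ∪ closedBall (0 : ℂ) r)ᶜ := by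
  set A : Set ℂ := {z | ‖z‖ ∈ Set.Ioo r 1} with hA
  have hApre : IsPreconnected A :=
    isPreconnected_setOf_norm_mem isPreconnected_Ioo fun t ht => h0.trans ht.1.le
  have hAU : A ⊆ (K ∪ closedBall (0 : ℂ) r)ᶜ := by
    rintro z hz (h | h)
    · exact Set.disjoint_left.1 hd h (by simpa using hz.2)
    · exact absurd hz.1 (by simpa using h)
  have hAne : A.Nonempty := by
    refine ⟨((r + 1) / 2 : ℝ), ?_⟩
    rw [hA, Set.mem_ofPred_eq, Complex.norm_real, Real.norm_of_nonneg (by linarith)]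
    constructor <;> linarith
  have hopen : IsOpen (K ∪ closedBall (0 : ℂ) r)ᶜ :=
    (hK.isClosed.union isClosed_closedBall).isOpen_compl
  refine ⟨hAne.mono hAU, ?_⟩
  have key : ∀ u v : Set ℂ, IsOpen u → IsOpen v → (K ∪ closedBall (0 : ℂ) r)ᶜ ⊆ u ∪ v →
      (K ∪ closedBall (0 : ℂ) r)ᶜ ∩ (u ∩ v) = ∅ → A ⊆ u → (K ∪ closedBall (0 : ℂ) r)ᶜ ⊆ u := by
    intro u v hu hv huv hdisj hAu z hz
    by_contra hzu
    have hzv : z ∈ v := (huv hz).resolve_left hzu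
    obtain ⟨x, -, hx⟩ := hc.isPreconnected
      ((K ∪ closedBall (0 : ℂ) r)ᶜ ∩ u ∪ ball 0 1) ((K ∪ closedBall (0 : ℂ) r)ᶜ ∩ v)
      ((hopen.inter hu).union isOpen_ball) (hopen.inter hv)
      (fun x hx => by
        rcases lt_or_ge ‖x‖ 1 with h | h
        · exact .inl (.inr (by simpa using h))
        · have hxU : x ∈ (K ∪ closedBall (0 : ℂ) r)ᶜ := by
            rintro (h' | h')
            · exact hx h'
            · rw [mem_closedBall_zero_iff] at h'
              linarith
          exact (huv hxU).imp (fun h => .inl ⟨hxU, h⟩) fun h => ⟨hxU, h⟩)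
      ⟨hAne.some, fun h => hAU hAne.some_mem (.inl h), .inl ⟨hAU hAne.some_mem, hAu hAne.some_mem⟩⟩
      ⟨z, fun h => hz (.inl h), hz, hzv⟩
    obtain ⟨hx | hx, hxU, hxv⟩ := hx
    · exact Set.eq_empty_iff_forall_notMem.1 hdisj x ⟨hxU, hx.2, hxv⟩
    · have hxA : x ∈ A := by
        refine ⟨?_, by simpa using hx⟩
        by_contra! h
        exact hxU (.inr (by simpa using h))
      exact Set.eq_empty_iff_forall_notMem.1 hdisj x ⟨hxU, hAu hxA, hxv⟩
  rw [isPreconnected_iff_subset_of_disjoint]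
  intro u v hu hv huv hdisj
  have hAd : A ∩ (u ∩ v) = ∅ := Set.subset_empty_iff.1
    (hdisj ▸ Set.inter_subset_inter_left _ hAU)
  rcases isPreconnected_iff_subset_of_disjoint.1 hApre u v hu hv (hAU.trans huv) hAd with h | h
  · exact .inl (key u v hu hv huv hdisj h)
  · exact .inr (key v u hv hu (Set.union_comm u v ▸ huv) (Set.inter_comm u v ▸ hdisj) h)

/-- A finite union of balls with centres in a fixed countable dense set. -/
def ballUnion (T : Finset (ℕ × ℕ)) : Set ℂ :=
  ⋃ p ∈ T, ball (TopologicalSpace.denseSeq ℂ p.1) (1 / (p.2 + 1))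

theorem isOpen_ballUnion (T : Finset (ℕ × ℕ)) : IsOpen (ballUnion T) :=
  isOpen_biUnion fun _ _ => isOpen_ball

theorem exists_ballUnion_cover {Γ U : Set ℂ} (hΓ : IsCompact Γ) (hU : IsOpen U) (hΓU : Γ ⊆ U) :
    ∃ T : Finset (ℕ × ℕ), Γ ⊆ ballUnion T ∧ ballUnion T ⊆ U ∧
      ∀ p ∈ T, (ball (TopologicalSpace.denseSeq ℂ p.1) (1 / (p.2 + 1)) ∩ Γ).Nonempty := by
  have hx : ∀ x : Γ, ∃ p : ℕ × ℕ, (x : ℂ) ∈ ball (TopologicalSpace.denseSeq ℂ p.1) (1 / (p.2 + 1)) ∧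
      ball (TopologicalSpace.denseSeq ℂ p.1) (1 / (p.2 + 1)) ⊆ U := by
    rintro ⟨x, hx⟩
    obtain ⟨ε, hε, hεU⟩ := Metric.isOpen_iff.1 hU x (hΓU hx)
    obtain ⟨n, hn⟩ := exists_nat_one_div_lt (half_pos hε)
    obtain ⟨k, hk⟩ := (TopologicalSpace.denseRange_denseSeq ℂ).exists_dist_lt x
      (Nat.one_div_pos_of_nat : (0 : ℝ) < 1 / (n + 1))
    refine ⟨(k, n), hk, (ball_subset_ball' ?_).trans hεU⟩
    rw [dist_comm]
    simp only
    linarith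
  choose p hp hpU using hx
  obtain ⟨t, ht⟩ := hΓ.elim_finite_subcover
    (fun x : Γ => ball (TopologicalSpace.denseSeq ℂ (p x).1) (1 / ((p x).2 + 1)))
    (fun _ => isOpen_ball) fun x hx => Set.mem_iUnion.2 ⟨⟨x, hx⟩, hp _⟩
  classical
  refine ⟨t.image p, ?_, ?_, ?_⟩
  · refine ht.trans fun x hx => ?_
    obtain ⟨i, hi, hxi⟩ := Set.mem_iUnion₂.1 hx
    exact Set.mem_iUnion₂.2 ⟨p i, Finset.mem_image_of_mem p hi, hxi⟩
  · refine Set.iUnion₂_subset fun q hq => ?_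
    obtain ⟨i, -, rfl⟩ := Finset.mem_image.1 hq
    exact hpU i
  · intro q hq
    obtain ⟨i, -, rfl⟩ := Finset.mem_image.1 hq
    exact ⟨i, hp i, i.2⟩

theorem exists_ballUnion_compact {K : Set ℂ} (hK : IsCompact K) (hc : IsConnected Kᶜ)
    (hd : Disjoint K (ball 0 1)) {a : ℂ} (ha : a ∉ K) :
    ∃ (T : Finset (ℕ × ℕ)) (N : ℕ), K ⊆ closedBall 0 N \ (ballUnion T ∪ ball 0 1) ∧
      a ∉ closedBall 0 N \ (ballUnion T ∪ ball 0 1) ∧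
      IsConnected (closedBall (0 : ℂ) N \ (ballUnion T ∪ ball 0 1))ᶜ := by
  obtain ⟨R, hR⟩ := hK.isBounded.subset_closedBall 0
  obtain ⟨N, hN⟩ := exists_nat_ge R
  obtain ⟨y, hyK, hy⟩ := exists_norm_gt_of_isCompact hK 0 N
  rw [sub_zero] at hy
  have h0 : (0 : ℂ) ∈ Kᶜ := fun h => Set.disjoint_left.1 hd h (by simp)
  have hp : IsPathConnected Kᶜ := hK.isClosed.isOpen_compl.isConnected_iff_isPathConnected.1 hc
  obtain ⟨γ₁, hγ₁⟩ := hp.joinedIn 0 h0 a ha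
  obtain ⟨γ₂, hγ₂⟩ := hp.joinedIn 0 h0 y hyK
  have hΓ0 : (0 : ℂ) ∈ Set.range γ₁ := ⟨0, γ₁.source⟩
  have hΓ0' : (0 : ℂ) ∈ Set.range γ₂ := ⟨0, γ₂.source⟩
  have hΓc : IsPreconnected (Set.range γ₁ ∪ Set.range γ₂) :=
    (isPreconnected_range γ₁.continuous).union 0 hΓ0 hΓ0' (isPreconnected_range γ₂.continuous)
  obtain ⟨T, hΓT, hTK, hT⟩ := exists_ballUnion_cover
    ((isCompact_range γ₁.continuous).union (isCompact_range γ₂.continuous))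
    hK.isClosed.isOpen_compl (Γ := Set.range γ₁ ∪ Set.range γ₂)
    (Set.union_subset (Set.range_subset_iff.2 hγ₁) (Set.range_subset_iff.2 hγ₂))
  set Γ := Set.range γ₁ ∪ Set.range γ₂ with hΓ
  have h0Γ : (0 : ℂ) ∈ Γ := .inl hΓ0
  refine ⟨T, N, fun z hz => ⟨closedBall_subset_closedBall hN (hR hz), ?_⟩, fun h => ?_, ?_, ?_⟩
  · rintro (h | h)
    · exact hTK h hz
    · exact Set.disjoint_left.1 hd hz h
  · exact h.2 (.inl (hΓT (.inl ⟨1, γ₁.target⟩)))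
  · exact ⟨0, fun h => h.2 (.inr (by simp))⟩
  · have heq : (closedBall (0 : ℂ) N \ (ballUnion T ∪ ball 0 1))ᶜ
        = ⋃₀ ({Γ ∪ ball 0 1, Γ ∪ {z | ‖z‖ ∈ Set.Ioi (N : ℝ)}} ∪
          (fun p : ℕ × ℕ => Γ ∪ ball (TopologicalSpace.denseSeq ℂ p.1) (1 / (p.2 + 1))) '' T) := by
      ext z
      simp only [Set.mem_compl_iff, Set.mem_sdiff, mem_closedBall_zero_iff, Set.mem_sUnion]
      constructor
      · intro h
        rcases lt_or_ge (N : ℝ) ‖z‖ with h' | h'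
        · exact ⟨_, .inl (.inr rfl), .inr h'⟩
        · rcases not_not.1 fun h'' => h ⟨h', h''⟩ with h | h
          · obtain ⟨p, hp, hz⟩ := Set.mem_iUnion₂.1 h
            exact ⟨_, .inr ⟨p, hp, rfl⟩, .inr hz⟩
          · exact ⟨_, .inl (.inl rfl), .inr h⟩
      · rintro ⟨s, (rfl | rfl) | ⟨p, hp, rfl⟩, hz | hz⟩ ⟨h1, h2⟩
        · exact h2 (.inl (hΓT hz))
        · exact h2 (.inr hz)
        · exact h2 (.inl (hΓT hz))
        · exact absurd h1 (not_le.2 hz)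
        · exact h2 (.inl (hΓT hz))
        · exact h2 (.inl (Set.mem_iUnion₂.2 ⟨p, hp, hz⟩))
    rw [heq]
    refine isPreconnected_sUnion 0 _ ?_ ?_
    · rintro s ((rfl | rfl) | ⟨p, hp, rfl⟩) <;> exact .inl h0Γ
    · rintro s ((rfl | rfl) | ⟨p, hp, rfl⟩)
      · exact hΓc.union 0 h0Γ (by simp) (convex_ball _ _).isPreconnected
      · exact hΓc.union y (.inr ⟨1, γ₂.target⟩) hy
          (isPreconnected_setOf_norm_mem isPreconnected_Ioi fun t ht =>
            (Nat.cast_nonneg N).trans (Set.mem_Ioi.1 ht).le)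
      · obtain ⟨x, hx, hxΓ⟩ := hT p hp
        exact hΓc.union x hxΓ hx (convex_ball _ _).isPreconnected

theorem exists_countable_compact_family (a : ℂ) :
    ∃ Kf : ℕ → Set ℂ, (∀ m, IsCompact (Kf m) ∧ IsConnected (Kf m)ᶜ ∧ Disjoint (Kf m) (ball 0 1) ∧
      a ∉ Kf m) ∧
      ∀ K : Set ℂ, IsCompact K → IsConnected Kᶜ → Disjoint K (ball 0 1) → a ∉ K → ∃ m, K ⊆ Kf m := by
  set S : Set (Set ℂ) := Set.range fun p : Finset (ℕ × ℕ) × ℕ =>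
    closedBall (0 : ℂ) p.2 \ (ballUnion p.1 ∪ ball 0 1) with hS
  have hSc : (insert ∅ {L ∈ S | IsConnected Lᶜ ∧ a ∉ L}).Countable :=
    ((Set.countable_range _).mono (Set.sep_subset _ _)).insert _
  obtain ⟨Kf, hKf⟩ := hSc.exists_eq_range (Set.insert_nonempty _ _)
  refine ⟨Kf, fun m => ?_, fun K hK hc hd ha => ?_⟩
  · have hm : Kf m ∈ insert ∅ {L ∈ S | IsConnected Lᶜ ∧ a ∉ L} := hKf ▸ Set.mem_range_self m
    rcases hm with hm | ⟨⟨p, hp⟩, hc, ha⟩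
    · rw [hm]
      simp [isConnected_univ]
    · refine ⟨?_, hc, ?_, ha⟩
      · rw [← hp]
        exact (isCompact_closedBall _ _).diff ((isOpen_ballUnion _).union isOpen_ball)
      · rw [← hp]
        exact Set.disjoint_left.2 fun z hz hz' => hz.2 (.inr hz')
  · obtain ⟨T, N, h1, h2, h3⟩ := exists_ballUnion_compact hK hc hd ha
    have hm : closedBall (0 : ℂ) N \ (ballUnion T ∪ ball 0 1) ∈ Set.range Kf :=
      hKf ▸ .inr ⟨⟨(T, N), rfl⟩, h3, h2⟩
    obtain ⟨m, hm⟩ := hm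
    exact ⟨m, hm ▸ h1⟩

theorem exists_polynomial_correction {K : Set ℂ} (hK : IsCompact K) (hc : IsConnected Kᶜ)
    (hd : Disjoint K (ball 0 1)) {a : ℂ} (ha : 1 ≤ ‖a‖) (haK : a ∉ K) (H P : ℂ[X]) (v : ℂ) (D : ℕ)
    {r : ℝ} (h0 : 0 ≤ r) (h1 : r < 1) {ε : ℝ} (hε : 0 < ε) :
    ∃ P' : ℂ[X], X ^ D ∣ P' - P ∧ (∀ z ∈ closedBall (0 : ℂ) r, ‖P'.eval z - P.eval z‖ < ε) ∧
      (∀ z ∈ K, ‖P'.eval z - H.eval z‖ < ε) ∧ P'.eval a = v := by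
  have ha0 : a ≠ 0 := norm_pos_iff.1 (by linarith)
  set c : ℂ := (v - P.eval a) / a ^ D with hcdef
  set L := K ∪ closedBall (0 : ℂ) r with hL
  have hLc : IsCompact L := hK.union (isCompact_closedBall 0 r)
  obtain ⟨M, hM0, hM⟩ := PolyApprox.exists_bound hLc
    (PolyApprox.polynomial L (X ^ D * (X - C a)))
  set g : ℂ → ℂ := fun z => if ‖z‖ < (r + 1) / 2 then -c / (z - a) else
    ((H.eval z - P.eval z) / z ^ D - c) / (z - a) with hg
  have hK1 : ∀ z ∈ K, 1 ≤ ‖z‖ := fun z hz => by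
    by_contra! h
    exact Set.disjoint_left.1 hd hz (by simpa using h)
  have hgB : ∀ z, ‖z‖ < (r + 1) / 2 → g z = -c / (z - a) := fun z hz => if_pos hz
  have hgK : ∀ z, (r + 1) / 2 < ‖z‖ → g z = ((H.eval z - P.eval z) / z ^ D - c) / (z - a) :=
    fun z hz => if_neg hz.not_gt
  have hBz : ∀ z ∈ closedBall (0 : ℂ) r, ‖z‖ < (r + 1) / 2 ∧ z - a ≠ 0 := by
    intro z hz
    rw [mem_closedBall_zero_iff] at hz
    refine ⟨by linarith, sub_ne_zero.2 fun h => ?_⟩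
    rw [h] at hz
    linarith
  have hKz : ∀ z ∈ K, (r + 1) / 2 < ‖z‖ ∧ z - a ≠ 0 ∧ z ≠ 0 := by
    intro z hz
    have := hK1 z hz
    exact ⟨by linarith, sub_ne_zero.2 fun h => haK (h ▸ hz), norm_pos_iff.1 (by linarith)⟩
  have hgd : ∀ z ∈ L, DifferentiableAt ℂ g z := by
    rintro z (hz | hz)
    · obtain ⟨hz1, hz2, hz3⟩ := hKz z hz
      have hd : DifferentiableAt ℂ (fun z => ((H.eval z - P.eval z) / z ^ D - c) / (z - a)) z :=
        (((H.differentiableAt.sub P.differentiableAt).div (differentiableAt_id.pow D)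
          (pow_ne_zero D hz3)).sub (differentiableAt_const c)).div (by fun_prop) hz2
      refine hd.congr_of_eventuallyEq ?_
      filter_upwards [(isOpen_lt continuous_const continuous_norm).mem_nhds hz1] with w hw
      exact hgK w hw
    · obtain ⟨hz1, hz2⟩ := hBz z hz
      have hd : DifferentiableAt ℂ (fun z => -c / (z - a)) z :=
        (differentiableAt_const (-c)).div (by fun_prop) hz2
      refine hd.congr_of_eventuallyEq ?_
      filter_upwards [(isOpen_lt continuous_norm continuous_const).mem_nhds hz1] with w hw
      exact hgB w hw
  obtain ⟨R, hR⟩ := PolyApprox.of_continuousOn hLc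
    (isConnected_compl_union_closedBall hK hc hd h0 h1)
    (fun z hz => (hgd z hz).continuousAt.continuousWithinAt)
    (fun z hz => (hgd z (interior_subset hz)).differentiableWithinAt) (ε / M) (by positivity)
  have hbound : ∀ z ∈ L, ‖z ^ D * (z - a) * (R.eval z - g z)‖ < ε := by
    intro z hz
    have h2 := hM z hz
    simp only [eval_mul, eval_pow, eval_X, eval_sub, eval_C] at h2
    rw [norm_mul]
    calc ‖z ^ D * (z - a)‖ * ‖R.eval z - g z‖ ≤ M * ‖R.eval z - g z‖ := by gcongr
      _ < M * (ε / M) := by gcongr; exact hR z hz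
      _ = ε := by field_simp
  refine ⟨P + X ^ D * (C c + (X - C a) * R), ⟨C c + (X - C a) * R, by ring⟩, fun z hz => ?_,
    fun z hz => ?_, ?_⟩
  · obtain ⟨hz1, hz2⟩ := hBz z hz
    refine lt_of_eq_of_lt ?_ (hbound z (.inr hz))
    rw [hgB z hz1]
    congr 1
    simp only [eval_add, eval_mul, eval_pow, eval_X, eval_sub, eval_C]
    field_simp
    ring
  · obtain ⟨hz1, hz2, hz3⟩ := hKz z hz
    refine lt_of_eq_of_lt ?_ (hbound z (.inl hz))
    rw [hgK z hz1]
    congr 1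
    simp only [eval_add, eval_mul, eval_pow, eval_X, eval_sub, eval_C]
    field_simp
    ring
  · simp only [eval_add, eval_mul, eval_pow, eval_X, eval_sub, eval_C, sub_self, zero_mul, add_zero,
      hcdef]
    field_simp
    ring

theorem hankelDet_ne_zero {α : ℕ → ℂ} {m q : ℕ} {P Q : ℂ[X]} (h : IsPade α m q P Q)
    (hQ : Q.natDegree = q) (hqm : q ≤ m) : hankelDet α m q ≠ 0 := by
  intro hdet
  obtain ⟨v, hv0, hv⟩ := Matrix.exists_mulVec_eq_zero_iff.2 hdet
  obtain ⟨hP, -, hcop, -, hS⟩ := h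
  set S := PowerSeries.mk α with hSdef
  set V : ℂ[X] := ∑ j : Fin q, C (v j) * X ^ (q - 1 - j : ℕ) with hV
  have hVcoeff : ∀ j : Fin q, V.coeff (q - 1 - j) = v j := by
    intro j
    simp only [hV, finsetSum_coeff, coeff_C_mul, coeff_X_pow, mul_ite, mul_one, mul_zero]
    rw [Finset.sum_eq_single j]
    · simp
    · intro i _ hij
      rw [if_neg]
      intro h
      exact hij (Fin.ext (by have := i.2; have := j.2; omega))
    · simp
  have hVne : V ≠ 0 := by
    intro h
    refine hv0 (funext fun j => ?_)
    rw [← hVcoeff j, h, coeff_zero, Pi.zero_apply]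
  have hVdeg : V.natDegree < q := by
    have hq : 0 < q := by
      rcases Nat.eq_zero_or_pos q with rfl | h
      · exact absurd (Subsingleton.elim v 0) hv0
      · exact h
    refine lt_of_le_of_lt (natDegree_sum_le_of_forall_le (n := q - 1) _ _ fun j _ => ?_)
      (Nat.sub_lt hq one_pos)
    exact (natDegree_C_mul_X_pow_le _ _).trans (Nat.sub_le _ _)
  have hVS : ∀ i < q, PowerSeries.coeff (m + i) ((V : PowerSeries ℂ) * S) = 0 := by
    intro i hi
    have h1 := congrFun hv ⟨i, hi⟩
    simp only [Matrix.mulVec, dotProduct, Matrix.of_apply, Pi.zero_apply] at h1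
    rw [← h1]
    have h2 : (V : PowerSeries ℂ) = ∑ j : Fin q, PowerSeries.C (v j) *
        PowerSeries.X ^ (q - 1 - j : ℕ) := by
      rw [hV, ← Polynomial.coeToPowerSeries.ringHom_apply, map_sum]
      simp
    rw [h2, Finset.sum_mul, map_sum]
    refine Finset.sum_congr rfl fun j _ => ?_
    have hj := j.2
    rw [mul_assoc, PowerSeries.coeff_C_mul, PowerSeries.coeff_X_pow_mul', if_pos (by omega), hSdef,
      PowerSeries.coeff_mk, acoefZ, if_pos (by omega), mul_comm]
    congr 2
    omega
  set R := PowerSeries.trunc m ((V : PowerSeries ℂ) * S) with hR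
  have hd1 : (PowerSeries.X : PowerSeries ℂ) ^ (m + q) ∣ (V : PowerSeries ℂ) * S - R := by
    refine PowerSeries.X_pow_dvd_iff.2 fun n hn => ?_
    rw [map_sub, Polynomial.coeff_coe, hR, PowerSeries.coeff_trunc]
    split_ifs with hnm
    · exact sub_self _
    · obtain ⟨i, rfl⟩ := Nat.exists_eq_add_of_le (not_lt.1 hnm)
      rw [hVS i (by omega), sub_zero]
  have hd2 : (PowerSeries.X : PowerSeries ℂ) ^ (m + q) ∣ (Q : PowerSeries ℂ) * S - P := by
    refine PowerSeries.X_pow_dvd_iff.2 fun n hn => ?_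
    rw [map_sub, Polynomial.coeff_coe, ← hS n hn.le, PowerSeries.coeff_mul,
      Finset.Nat.sum_antidiagonal_eq_sum_range_succ
        (fun i j => PowerSeries.coeff i (Q : PowerSeries ℂ) * PowerSeries.coeff j S)]
    simp [hSdef]
  have hd3 : (PowerSeries.X : PowerSeries ℂ) ^ (m + q) ∣ ((V * P - Q * R : ℂ[X]) : PowerSeries ℂ) := by
    have h1 := (hd1.mul_left (Q : PowerSeries ℂ)).sub (hd2.mul_left (V : PowerSeries ℂ))
    convert h1 using 1
    push_cast
    ring
  have heq : V * P - Q * R = 0 := by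
    have hlt : (V * P - Q * R).natDegree < m + q := by
      refine lt_of_le_of_lt (natDegree_sub_le _ _) (max_lt ?_ ?_)
      · exact natDegree_mul_le.trans_lt (by omega)
      · rcases eq_or_ne R 0 with h0 | h0
        · rw [h0, mul_zero, natDegree_zero]
          omega
        · have : R.natDegree < m := by
            refine (natDegree_lt_iff_degree_lt h0).2 (PowerSeries.degree_trunc_lt _ _)
          exact natDegree_mul_le.trans_lt (by omega)
    ext n
    rcases lt_or_ge n (m + q) with hn | hn
    · have := PowerSeries.X_pow_dvd_iff.1 hd3 n hn
      rwa [Polynomial.coeff_coe] at this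
    · exact coeff_eq_zero_of_natDegree_lt (hlt.trans_le hn)
  have hQV : Q ∣ V := hcop.symm.dvd_of_dvd_mul_right ⟨R, sub_eq_zero.1 heq⟩
  have := natDegree_le_of_dvd hQV hVne
  omega

theorem tc_polynomial (p : ℂ[X]) (k : ℕ) : tc (fun z => p.eval z) k = p.coeff k := by
  have h : ∀ (k : ℕ) (p : ℂ[X]), iteratedDeriv k (fun z => p.eval z) 0 = k.factorial * p.coeff k := by
    intro k
    induction k with
    | zero => intro p; simp [coeff_zero_eq_eval_zero]
    | succ k ih =>
      intro p
      rw [iteratedDeriv_succ']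
      have : deriv (fun z => p.eval z) = fun z => (derivative p).eval z := by
        ext z
        exact p.deriv
      rw [this, ih, coeff_derivative, Nat.factorial_succ]
      push_cast
      ring
  rw [tc, h, mul_div_cancel_left₀]
  exact_mod_cast k.factorial_ne_zero

theorem tc_mul {f g : ℂ → ℂ} (hf : AnalyticAt ℂ f 0) (hg : AnalyticAt ℂ g 0) (n : ℕ) :
    tc (fun z => f z * g z) n = ∑ i ∈ range (n + 1), tc f i * tc g (n - i) := by
  rw [tc, iteratedDeriv_fun_mul hf.contDiffAt hg.contDiffAt, Finset.sum_div]
  refine Finset.sum_congr rfl fun i hi => ?_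
  have hin : i ≤ n := Nat.lt_succ_iff.1 (Finset.mem_range.1 hi)
  rw [Nat.cast_choose ℂ hin, tc, tc]
  have h1 : (n.factorial : ℂ) ≠ 0 := by exact_mod_cast n.factorial_ne_zero
  have h2 : (i.factorial : ℂ) ≠ 0 := by exact_mod_cast i.factorial_ne_zero
  have h3 : ((n - i).factorial : ℂ) ≠ 0 := by exact_mod_cast (n - i).factorial_ne_zero
  field_simp

theorem tc_congr {f g : ℂ → ℂ} (h : f =ᶠ[𝓝 0] g) (n : ℕ) : tc f n = tc g n := by
  rw [tc, tc, h.iteratedDeriv_eq]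

theorem tendsto_tc {U : Set ℂ} (hU : IsOpen U) (h0 : (0 : ℂ) ∈ U) {F : ℕ → ℂ → ℂ} {f : ℂ → ℂ}
    (hF : ∀ n, DifferentiableOn ℂ (F n) U) (h : TendstoLocallyUniformlyOn F f atTop U) (k : ℕ) :
    Tendsto (fun n => tc (F n) k) atTop (𝓝 (tc f k)) := by
  have key : ∀ k, (∀ n, DifferentiableOn ℂ (iteratedDeriv k (F n)) U) ∧
      TendstoLocallyUniformlyOn (fun n => iteratedDeriv k (F n)) (iteratedDeriv k f) atTop U := by
    intro k
    induction k with
    | zero => simpa using ⟨hF, h⟩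
    | succ k ih =>
      simp only [iteratedDeriv_succ]
      exact ⟨fun n => (ih.1 n).deriv hU, ih.2.deriv (.of_forall ih.1) hU⟩
  exact ((key k).2.tendsto_at h0).div_const _

theorem TendstoUniformlyOn.mul_of_bounded {ι : Type*} {l : Filter ι} {F : ι → ℂ → ℂ} {g c : ℂ → ℂ}
    {s : Set ℂ} (h : TendstoUniformlyOn F g l s) {B : ℝ} (hB : ∀ z ∈ s, ‖c z‖ ≤ B) :
    TendstoUniformlyOn (fun i z => F i z * c z) (fun z => g z * c z) l s := by
  rw [Metric.tendstoUniformlyOn_iff] at h ⊢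
  intro ε hε
  have hB' : 0 < |B| + 1 := by positivity
  filter_upwards [h (ε / (|B| + 1)) (by positivity)] with i hi z hz
  have h1 := hi z hz
  rw [dist_eq_norm] at h1 ⊢
  rw [← sub_mul, norm_mul]
  calc ‖g z - F i z‖ * ‖c z‖ ≤ ‖g z - F i z‖ * (|B| + 1) := by
        gcongr
        exact (hB z hz).trans ((le_abs_self B).trans (by linarith))
    _ < ε / (|B| + 1) * (|B| + 1) := by gcongr
    _ = ε := by field_simp

section LinearPower

variable {a : ℂ} {q : ℕ}

theorem eval_one_sub_pow (a z : ℂ) (q : ℕ) :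
    ((1 - C a⁻¹ * X : ℂ[X]) ^ q).eval z = (1 - a⁻¹ * z) ^ q := by
  simp

theorem one_sub_eq (ha : a ≠ 0) : (1 - C a⁻¹ * X : ℂ[X]) = C (-a⁻¹) * (X - C a) := by
  rw [mul_sub, ← C_mul, neg_mul, inv_mul_cancel₀ ha]
  simp
  ring

theorem natDegree_one_sub_pow (ha : a ≠ 0) : ((1 - C a⁻¹ * X : ℂ[X]) ^ q).natDegree = q := by
  rw [natDegree_pow, one_sub_eq ha, natDegree_C_mul (by simpa using ha), natDegree_X_sub_C, mul_one]

theorem isCoprime_one_sub_pow (ha : a ≠ 0) {P : ℂ[X]} (hP : P.eval a ≠ 0) :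
    IsCoprime P ((1 - C a⁻¹ * X : ℂ[X]) ^ q) := by
  refine IsCoprime.pow_right ?_
  rw [one_sub_eq ha]
  refine IsCoprime.mul_right ?_ ?_
  · exact (isCoprime_one_right).of_isCoprime_of_dvd_right
      (isUnit_iff_dvd_one.1 (isUnit_C.2 (by simpa using ha)))
  · refine (((irreducible_X_sub_C a).coprime_iff_not_dvd).2 fun h => hP ?_).symm
    exact dvd_iff_isRoot.1 h

theorem one_sub_pow_ne_zero (ha : a ≠ 0) {z : ℂ} (hz : z ≠ a) : (1 - a⁻¹ * z) ^ q ≠ 0 := by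
  refine pow_ne_zero _ fun h => hz ?_
  rw [sub_eq_zero, eq_inv_mul_iff_mul_eq₀ ha, mul_one] at h
  exact h.symm

end LinearPower

theorem one_sub_pow_ne_zero_of_mem_ball {a : ℂ} (ha : 1 ≤ ‖a‖) (q : ℕ) {z : ℂ}
    (hz : z ∈ ball (0 : ℂ) 1) : (1 - a⁻¹ * z) ^ q ≠ 0 := by
  refine one_sub_pow_ne_zero (norm_pos_iff.1 (by linarith)) fun h => ?_
  rw [mem_ball_zero_iff, h] at hz
  linarith

theorem exists_lt_one_subset_closedBall {L : Set ℂ} (hL : IsCompact L) (hLD : L ⊆ ball 0 1) :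
    ∃ r < 1, L ⊆ closedBall 0 r := by
  rcases L.eq_empty_or_nonempty with rfl | hne
  · exact ⟨0, one_pos, Set.empty_subset _⟩
  · obtain ⟨z, hz, hmax⟩ := hL.exists_isMaxOn hne continuous_norm.continuousOn
    exact ⟨‖z‖, mem_ball_zero_iff.1 (hLD hz), fun w hw => mem_closedBall_zero_iff.2 (hmax hw)⟩

theorem mem_UQset_of_forall {μ : ℕ → ℕ} {a : ℂ} (ha : 1 ≤ ‖a‖) {q : ℕ} (hq : 1 ≤ q)
    {Kf : ℕ → Set ℂ}
    (hKf : ∀ K, IsCompact K → IsConnected Kᶜ → Disjoint K (ball 0 1) → a ∉ K → ∃ m, K ⊆ Kf m)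
    {f : Hol unitD} {g : ℂ → ℂ} (hg : ∀ z ∈ ball (0 : ℂ) 1, (1 - a⁻¹ * z) ^ q * f.1 z = g z)
    (H : ∀ (m : ℕ) (H : ℂ[X]), ∀ ε > 0, ∀ N : ℕ, ∃ i ≥ N, N ≤ μ i ∧ ∃ P : ℂ[X],
      P.natDegree ≤ μ i ∧ P.eval a ≠ 0 ∧ (∀ j ≤ μ i + q, tc g j = P.coeff j) ∧
      ∀ z ∈ Kf m, ‖P.eval z - H.eval z‖ < ε) :
    f ∈ UQset μ q ((1 - C a⁻¹ * X) ^ q) {z : ℂ | ((1 - C a⁻¹ * X) ^ q).eval z = 0} := by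
  have ha0 : a ≠ 0 := norm_pos_iff.1 (by linarith)
  intro K hK hKd hKc h hh hhd
  rw [Set.disjoint_union_right] at hKd
  have haK : a ∉ K := fun haK => Set.disjoint_left.1 hKd.2 haK (by
    rw [Set.mem_ofPred_eq, eval_one_sub_pow, inv_mul_cancel₀ ha0, sub_self, zero_pow (by omega)])
  obtain ⟨m, hm⟩ := hKf K hK hKc hKd.1 haK
  have hQK : ∀ z ∈ K, (1 - a⁻¹ * z) ^ q ≠ 0 :=
    fun z hz => one_sub_pow_ne_zero ha0 fun h => haK (h ▸ hz)
  have hQD : ∀ z ∈ ball (0 : ℂ) 1, (1 - a⁻¹ * z) ^ q ≠ 0 :=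
    fun z hz => one_sub_pow_ne_zero_of_mem_ball ha q hz
  have hfd : DifferentiableOn ℂ f.1 (ball 0 1) := f.2.1
  have hgd : DifferentiableOn ℂ g (ball 0 1) := by
    refine DifferentiableOn.congr (f := fun z => (1 - a⁻¹ * z) ^ q * f.1 z) ?_
      fun z hz => (hg z hz).symm
    exact (by fun_prop : Differentiable ℂ fun z : ℂ => (1 - a⁻¹ * z) ^ q).differentiableOn.mul hfd
  have happ : PolyApprox K (fun z => (1 - a⁻¹ * z) ^ q * h z) := by
    refine PolyApprox.of_continuousOn hK hKc ?_ ?_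
    · exact (by fun_prop : Continuous fun z : ℂ => (1 - a⁻¹ * z) ^ q).continuousOn.mul hh
    · exact (by fun_prop : Differentiable ℂ fun z : ℂ => (1 - a⁻¹ * z) ^ q).differentiableOn.mul hhd
  choose R hR using fun k : ℕ => happ (1 / (k + 1)) (by positivity)
  obtain ⟨σ, hσ, hP⟩ := extraction_forall_of_frequently
    (P := fun k i => k + q ≤ μ i ∧ ∃ P : ℂ[X], P.natDegree ≤ μ i ∧ P.eval a ≠ 0 ∧
      (∀ j ≤ μ i + q, tc g j = P.coeff j) ∧
      ∀ z ∈ Kf m, ‖P.eval z - (R k).eval z‖ < 1 / ((k : ℝ) + 1)) fun k => by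
    rw [frequently_atTop]
    intro N
    obtain ⟨i, hi, hi2, P, hP1, hP2, hP3, hP4⟩ := H m (R k) (1 / (k + 1)) (by positivity) (N + k + q)
    exact ⟨i, by omega, by omega, P, hP1, hP2, hP3, hP4⟩
  choose hμ P hP1 hP2 hP3 hP4 using hP
  have htc : ∀ j, ∑ i ∈ range (j + 1), ((1 - C a⁻¹ * X : ℂ[X]) ^ q).coeff i * tc f.1 (j - i) =
      tc g j := by
    intro j
    have hnhds : ball (0 : ℂ) 1 ∈ 𝓝 0 := ball_mem_nhds 0 one_pos
    have h1 := tc_mul (f := fun z => ((1 - C a⁻¹ * X : ℂ[X]) ^ q).eval z)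
      ((Differentiable.analyticAt (Polynomial.differentiable _) _)) (hfd.analyticAt hnhds) j
    simp only [tc_polynomial] at h1
    rw [← h1]
    refine tc_congr ?_ j
    filter_upwards [hnhds] with z hz
    rw [eval_one_sub_pow, hg z hz]
  have hpade : ∀ k, IsPade (tc f.1) (μ (σ k)) q (P k) ((1 - C a⁻¹ * X) ^ q) := fun k =>
    ⟨hP1 k, (natDegree_one_sub_pow ha0).le, isCoprime_one_sub_pow ha0 (hP2 k),
      by simp [coeff_zero_eq_eval_zero], fun j hj => (htc j).trans (hP3 k j hj)⟩
  refine ⟨σ, hσ, P, fun k => ⟨⟨?_, _, _, hpade k, ?_⟩, hpade k⟩, ?_, ?_⟩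
  · exact hankelDet_ne_zero (hpade k) (natDegree_one_sub_pow ha0) (by linarith [hμ k])
  · have hd := natDegree_one_sub_pow (q := q) ha0
    rw [degree_eq_natDegree (fun h0 => by rw [h0, natDegree_zero] at hd; omega), hd]
  · have h1 : TendstoUniformlyOn (fun k z => (P k).eval z) (fun z => (1 - a⁻¹ * z) ^ q * h z)
        atTop K := by
      rw [Metric.tendstoUniformlyOn_iff]
      intro ε hε
      have hlim := (tendsto_one_div_add_atTop_nhds_zero_nat (𝕜 := ℝ)).eventually_lt_const
        (half_pos hε)
      filter_upwards [hlim] with k hk z hz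
      rw [dist_comm, dist_eq_norm]
      calc ‖(P k).eval z - (1 - a⁻¹ * z) ^ q * h z‖
          ≤ ‖(P k).eval z - (R k).eval z‖ + ‖(R k).eval z - (1 - a⁻¹ * z) ^ q * h z‖ :=
            norm_sub_le_norm_sub_add_norm_sub _ _ _
        _ < ε / 2 + ε / 2 :=
            add_lt_add ((hP4 k z (hm hz)).trans hk) ((hR k z hz).trans hk)
        _ = ε := add_halves ε
    obtain ⟨B, hB⟩ := hK.exists_bound_of_continuousOn (f := fun z => ((1 - a⁻¹ * z) ^ q)⁻¹)
      (ContinuousOn.inv₀ (by fun_prop) hQK)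
    refine ((h1.mul_of_bounded hB).congr_right fun z hz => ?_).congr (.of_forall fun k z hz => ?_)
    · rw [mul_right_comm, mul_inv_cancel₀ (hQK z hz), one_mul]
    · simp only [eval_one_sub_pow, div_eq_mul_inv]
  · refine (tendstoLocallyUniformlyOn_iff_forall_isCompact (s := unitD) isOpen_ball).2 ?_
    intro L hLD hL
    obtain ⟨r, hr1, hLr⟩ := exists_lt_one_subset_closedBall hL hLD
    have hμσ : Tendsto (fun k => μ (σ k) + 1) atTop atTop :=
      tendsto_atTop_mono (fun k => show k ≤ μ (σ k) + 1 by have := hμ k; omega) tendsto_id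
    have h1 : TendstoUniformlyOn (fun k z => (P k).eval z) g atTop L := by
      have h2 := (tendstoUniformlyOn_sum_tc hgd hr1).mono hLr
      refine TendstoUniformlyOn.congr (F := fun k z => ∑ j ∈ range (μ (σ k) + 1), tc g j * z ^ j) ?_
        (.of_forall fun k z hz => ?_)
      · intro u hu
        exact hμσ.eventually (h2 u hu)
      · simp only
        rw [eval_eq_sum_range' (Nat.lt_succ_iff.2 (hP1 k))]
        refine Finset.sum_congr rfl fun j hj => ?_
        rw [hP3 k j (by have := Finset.mem_range.1 hj; omega)]
    obtain ⟨B, hB⟩ := hL.exists_bound_of_continuousOn (f := fun z => ((1 - a⁻¹ * z) ^ q)⁻¹)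
      (ContinuousOn.inv₀ (by fun_prop) fun z hz => hQD z (hLD hz))
    refine ((h1.mul_of_bounded hB).congr_right fun z hz => ?_).congr (.of_forall fun k z hz => ?_)
    · rw [← hg z (hLD hz), mul_right_comm, mul_inv_cancel₀ (hQD z (hLD hz)), one_mul]
    · simp only [eval_one_sub_pow, div_eq_mul_inv]

theorem exists_dense_polynomials : ∃ T : ℕ → ℂ[X], ∀ K : Set ℂ, IsCompact K → ∀ p : ℂ[X], ∀ ε > 0,
    ∃ t, ∀ z ∈ K, ‖(T t).eval z - p.eval z‖ < ε := by
  let W : ℕ × ℕ → ℂ[X] := fun t => ∑ i : Fin t.1,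
    C (TopologicalSpace.denseSeq (Fin t.1 → ℂ) t.2 i) * X ^ (i : ℕ)
  refine ⟨fun t => W t.unpair, ?_⟩
  intro K hK p ε hε
  obtain ⟨B, hB0, hB⟩ := hK.isBounded.exists_pos_norm_le
  set d := p.natDegree + 1 with hd
  set S := ∑ i : Fin d, B ^ (i : ℕ) with hS
  have hS0 : 0 ≤ S := Finset.sum_nonneg fun i _ => by positivity
  obtain ⟨n, hn⟩ := (TopologicalSpace.denseRange_denseSeq (Fin d → ℂ)).exists_dist_lt
    (fun i => p.coeff i) (ε := ε / (S + 1)) (by positivity)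
  refine ⟨Nat.pair d n, fun z hz => ?_⟩
  simp only [Nat.unpair_pair, W]
  rw [eval_eq_sum_range' (Nat.lt_succ_self p.natDegree), ← Fin.sum_univ_eq_sum_range
    (fun i => p.coeff i * z ^ i), eval_finsetSum, ← Finset.sum_sub_distrib]
  simp only [eval_mul, eval_C, eval_pow, eval_X, ← sub_mul]
  calc _ ≤ ∑ i : Fin d, ε / (S + 1) * B ^ (i : ℕ) := by
        refine norm_sum_le_of_le _ fun i _ => ?_
        rw [norm_mul, norm_pow, ← dist_eq_norm, dist_comm]
        gcongr
        · exact ((dist_le_pi_dist _ _ i).trans_lt hn).le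
        · exact hB z hz
    _ = ε / (S + 1) * S := by rw [← Finset.mul_sum]
    _ < ε / (S + 1) * (S + 1) := by gcongr; linarith
    _ = ε := by field_simp

theorem closedBall_radius_mono {m n : ℕ} (h : m ≤ n) :
    closedBall (0 : ℂ) (1 - 1 / ((m : ℝ) + 2)) ⊆ closedBall 0 (1 - 1 / ((n : ℝ) + 2)) := by
  refine closedBall_subset_closedBall ?_
  gcongr

theorem exists_subset_closedBall {L : Set ℂ} (hL : IsCompact L) (hLD : L ⊆ ball 0 1) :
    ∃ n : ℕ, L ⊆ closedBall 0 (1 - 1 / ((n : ℝ) + 2)) := by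
  obtain ⟨r, hr1, hLr⟩ := exists_lt_one_subset_closedBall hL hLD
  obtain ⟨n, hn⟩ := exists_nat_one_div_lt (sub_pos.2 hr1)
  refine ⟨n, hLr.trans (closedBall_subset_closedBall ?_)⟩
  have : 1 / ((n : ℝ) + 2) ≤ 1 / (n + 1) := by gcongr; norm_num
  linarith

theorem tendstoLocallyUniformlyOn_of_norm_le {F : ℕ → ℂ → ℂ} {g : ℂ → ℂ} {u : ℕ → ℝ}
    (hu : Tendsto u atTop (𝓝 0))
    (h : ∀ n : ℕ, ∀ z ∈ closedBall (0 : ℂ) (1 - 1 / ((n : ℝ) + 2)), ‖g z - F n z‖ ≤ u n) :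
    TendstoLocallyUniformlyOn F g atTop (ball 0 1) := by
  rw [tendstoLocallyUniformlyOn_iff_forall_isCompact isOpen_ball]
  intro L hLD hL
  obtain ⟨m, hm⟩ := exists_subset_closedBall hL hLD
  rw [Metric.tendstoUniformlyOn_iff]
  intro ε hε
  filter_upwards [hu.eventually_lt_const hε, eventually_ge_atTop m] with n hn hmn z hz
  rw [dist_eq_norm]
  exact (h n z (closedBall_radius_mono hmn (hm hz))).trans_lt hn

theorem exists_limit_of_geometric {F : ℕ → ℂ → ℂ}
    (hF : ∀ n : ℕ, ∀ z ∈ closedBall (0 : ℂ) (1 - 1 / ((n : ℝ) + 2)),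
      ‖F (n + 1) z - F n z‖ ≤ (1 / 2) ^ n) :
    ∃ g : ℂ → ℂ, ∀ n : ℕ, ∀ z ∈ closedBall (0 : ℂ) (1 - 1 / ((n : ℝ) + 2)),
      ‖g z - F n z‖ ≤ 2 * (1 / 2) ^ n := by
  refine ⟨fun z => limUnder atTop fun n => F n z, fun n z hz => ?_⟩
  have h1 : ∀ j, dist (F (j + n) z) (F (j + 1 + n) z) ≤ (1 / 2) ^ n * (1 / 2) ^ j := by
    intro j
    rw [dist_comm, dist_eq_norm, ← pow_add, add_comm n j, add_right_comm]
    exact hF (j + n) z (closedBall_radius_mono (Nat.le_add_left n j) hz)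
  obtain ⟨l, hl⟩ := cauchySeq_tendsto_of_complete
    (cauchySeq_of_le_geometric (f := fun j => F (j + n) z) _ _ one_half_lt_one h1)
  have h2 := dist_le_of_le_geometric_of_tendsto₀ (f := fun j => F (j + n) z) _ _ one_half_lt_one h1 hl
  have h3 : Tendsto (fun j => F j z) atTop (𝓝 l) := (tendsto_add_atTop_iff_nat n).1 hl
  simp only [h3.limUnder_eq]
  rw [← dist_eq_norm, dist_comm]
  refine (le_of_eq ?_).trans (h2.trans (le_of_eq ?_))
  · simp
  · ring

theorem tendsto_hol_unitD {F : ℕ → Hol unitD} {f : Hol unitD}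
    (h : TendstoLocallyUniformlyOn (fun n => (F n).1) f.1 atTop unitD) :
    Tendsto F atTop (𝓝 f) := by
  rw [nhds_induced, tendsto_comap_iff, UniformOnFun.tendsto_iff_tendstoUniformlyOn]
  intro K hK
  have h1 := (tendstoLocallyUniformlyOn_iff_forall_isCompact (s := unitD) isOpen_ball).1 h
    (Subtype.val '' K) (Subtype.coe_image_subset _ _) (hK.image continuous_subtype_val)
  rw [Metric.tendstoUniformlyOn_iff] at h1 ⊢
  intro ε hε
  filter_upwards [h1 ε hε] with n hn z hz
  exact hn z ⟨z, hz, rfl⟩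

theorem exists_gt_of_unbounded {μ : ℕ → ℕ} (hμ : ∀ N : ℕ, ∃ k, N < μ k) (i N : ℕ) :
    ∃ j > i, N < μ j := by
  obtain ⟨j, hj⟩ := hμ (N + ∑ l ∈ range (i + 1), μ l)
  refine ⟨j, not_le.1 fun hji => ?_, by omega⟩
  have := Finset.single_le_sum (f := μ) (fun _ _ => Nat.zero_le _)
    (Finset.mem_range.2 (show j < i + 1 by omega))
  omega

theorem exists_universal_polynomials {μ : ℕ → ℕ} (hμ : ∀ N : ℕ, ∃ k, N < μ k) {a : ℂ} (ha : 1 ≤ ‖a‖)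
    (q : ℕ) {Kf : ℕ → Set ℂ} (hKf : ∀ m, IsCompact (Kf m) ∧ IsConnected (Kf m)ᶜ ∧
      Disjoint (Kf m) (ball 0 1) ∧ a ∉ Kf m) (T D : ℕ → ℂ[X]) (τ : ℕ → ℕ × ℕ × ℕ) :
    ∃ (G : ℕ → ℕ → ℂ[X]) (ι : ℕ → ℕ), StrictMono ι ∧ StrictMono (fun n => μ (ι n)) ∧
      (∀ k, G k k = D k) ∧
      (∀ n k, X ^ (μ (ι n) + q + 1) ∣ G (n + 1) k - G n k) ∧
      (∀ n k, n < k → G (n + 1) k = G n k) ∧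
      (∀ n k : ℕ, ∀ z ∈ closedBall (0 : ℂ) (1 - 1 / ((n : ℝ) + 2)),
        ‖(G (n + 1) k).eval z - (G n k).eval z‖ ≤ (1 / 2) ^ n) ∧
      (∀ n, ∀ k ≤ n, (G (n + 1) k).natDegree ≤ μ (ι (n + 1)) ∧
        (G (n + 1) k).eval a = (if k = (τ n).1 then 1 else 0) ∧
        ∀ z ∈ Kf (τ n).2.1, ‖(G (n + 1) k).eval z -
          (if k = (τ n).1 then 1 else 0) * (T (τ n).2.2).eval z‖ < (1 / 2) ^ n) := by
  have hstep : ∀ (n : ℕ) (S : (ℕ → ℂ[X]) × ℕ), ∃ S' : (ℕ → ℂ[X]) × ℕ,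
      S.2 < S'.2 ∧ μ S.2 < μ S'.2 ∧ (∀ k, X ^ (μ S.2 + q + 1) ∣ S'.1 k - S.1 k) ∧
      (∀ k, n < k → S'.1 k = S.1 k) ∧
      (∀ k, ∀ z ∈ closedBall (0 : ℂ) (1 - 1 / ((n : ℝ) + 2)),
        ‖(S'.1 k).eval z - (S.1 k).eval z‖ ≤ (1 / 2) ^ n) ∧
      (∀ k ≤ n, (S'.1 k).natDegree ≤ μ S'.2 ∧
        (S'.1 k).eval a = (if k = (τ n).1 then 1 else 0) ∧
        ∀ z ∈ Kf (τ n).2.1, ‖(S'.1 k).eval z -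
          (if k = (τ n).1 then 1 else 0) * (T (τ n).2.2).eval z‖ < (1 / 2) ^ n) := by
    rintro n ⟨G, i⟩
    obtain ⟨h1, h2, h3, h4⟩ := hKf (τ n).2.1
    have hr0 : 0 ≤ 1 - 1 / ((n : ℝ) + 2) := by
      rw [sub_nonneg, div_le_one (by positivity)]
      linarith [(Nat.cast_nonneg n : (0 : ℝ) ≤ n)]
    have hr1 : 1 - 1 / ((n : ℝ) + 2) < 1 := sub_lt_self _ (by positivity)
    choose P hP1 hP2 hP3 hP4 using fun k => exists_polynomial_correction h1 h2 h3 ha h4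
      (C (if k = (τ n).1 then 1 else 0) * T (τ n).2.2) (G k) (if k = (τ n).1 then 1 else 0)
      (μ i + q + 1) hr0 hr1 (by positivity : (0 : ℝ) < (1 / 2) ^ n)
    obtain ⟨j, hij, hj⟩ := exists_gt_of_unbounded hμ i
      (μ i + ∑ k ∈ range (n + 1), (P k).natDegree)
    refine ⟨(fun k => if k ≤ n then P k else G k, j), hij, by dsimp only; omega, fun k => ?_, fun k hk => ?_,
      fun k z hz => ?_, fun k hk => ?_⟩
    · dsimp only
      split_ifs
      · exact hP1 k
      · simp
    · exact if_neg (not_le.2 hk)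
    · dsimp only
      split_ifs
      · exact (hP2 k z hz).le
      · simp
    · simp only [if_pos hk]
      refine ⟨?_, hP4 k, fun z hz => ?_⟩
      · have := Finset.single_le_sum (f := fun k => (P k).natDegree) (fun _ _ => Nat.zero_le _)
          (Finset.mem_range.2 (show k < n + 1 by omega))
        omega
      · simpa only [eval_mul, eval_C] using hP3 k z hz
  choose step h1 h2 h3 h4 h5 h6 using hstep
  let S : ℕ → (ℕ → ℂ[X]) × ℕ := fun n => Nat.rec (D, 0) step n
  have hS : ∀ n, S (n + 1) = step n (S n) := fun _ => rfl
  have h4' : ∀ n k, n < k → (S (n + 1)).1 k = (S n).1 k := fun n k hk => h4 n (S n) k hk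
  refine ⟨fun n => (S n).1, fun n => (S n).2, strictMono_nat_of_lt_succ fun n => h1 n (S n),
    strictMono_nat_of_lt_succ fun n => h2 n (S n), fun k => ?_, fun n => h3 n (S n), h4',
    fun n => h5 n (S n), fun n => h6 n (S n)⟩
  have : ∀ n ≤ k, (S n).1 k = D k := by
    intro n
    induction n with
    | zero => intro _; rfl
    | succ n ih => intro hn; rw [h4' n k hn, ih (by omega)]
  exact this k le_rfl

theorem exists_universal_family {μ : ℕ → ℕ} (hμ : ∀ N : ℕ, ∃ k, N < μ k) {a : ℂ} (ha : 1 ≤ ‖a‖)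
    (q : ℕ) {Kf : ℕ → Set ℂ} (hKf : ∀ m, IsCompact (Kf m) ∧ IsConnected (Kf m)ᶜ ∧
      Disjoint (Kf m) (ball 0 1) ∧ a ∉ Kf m) (T D : ℕ → ℂ[X]) (τ : ℕ → ℕ × ℕ × ℕ) :
    ∃ g : ℕ → ℂ → ℂ, (∀ k, DifferentiableOn ℂ (g k) (ball 0 1)) ∧
      (∀ k : ℕ, ∀ z ∈ closedBall (0 : ℂ) (1 - 1 / ((k : ℝ) + 2)),
        ‖g k z - (D k).eval z‖ ≤ 2 * (1 / 2) ^ k) ∧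
      ∀ n, ∃ i ≥ n, n ≤ μ i ∧ ∃ P : ℕ → ℂ[X], ∀ k ≤ n, (P k).natDegree ≤ μ i ∧
        (P k).eval a = (if k = (τ n).1 then 1 else 0) ∧
        (∀ j ≤ μ i + q, tc (g k) j = (P k).coeff j) ∧
        ∀ z ∈ Kf (τ n).2.1, ‖(P k).eval z -
          (if k = (τ n).1 then 1 else 0) * (T (τ n).2.2).eval z‖ < (1 / 2) ^ n := by
  obtain ⟨G, ι, hι, hμι, hD, hdvd, -, hG, hP⟩ := exists_universal_polynomials hμ ha q hKf T D τ
  choose g hg using fun k => exists_limit_of_geometric (F := fun n z => (G n k).eval z)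
    fun n => hG n k
  have hloc : ∀ k, TendstoLocallyUniformlyOn (fun n z => (G n k).eval z) (g k) atTop (ball 0 1) := by
    refine fun k => tendstoLocallyUniformlyOn_of_norm_le (u := fun n => 2 * (1 / 2) ^ n) ?_ (hg k)
    simpa using (tendsto_pow_atTop_nhds_zero_of_lt_one (by norm_num : (0 : ℝ) ≤ 1 / 2)
      one_half_lt_one).const_mul 2
  have hdiff : ∀ n k, DifferentiableOn ℂ (fun z => (G n k).eval z) (ball 0 1) :=
    fun n k => (G n k).differentiable.differentiableOn
  refine ⟨g, fun k => (hloc k).differentiableOn (.of_forall fun n => hdiff n k) isOpen_ball,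
    fun k z hz => ?_, fun n => ⟨ι (n + 1), (Nat.le_succ n).trans hι.le_apply,
      (Nat.le_succ n).trans hμι.le_apply, G (n + 1), fun k hk => ?_⟩⟩
  · have := hg k k z hz
    rwa [hD] at this
  · obtain ⟨h1, h2, h3⟩ := hP n k hk
    refine ⟨h1, h2, fun j hj => ?_, h3⟩
    have hstab : ∀ l, (G (n + 1 + l) k).coeff j = (G (n + 1) k).coeff j := by
      intro l
      induction l with
      | zero => rfl
      | succ l ih =>
        rw [← ih, ← sub_eq_zero, ← coeff_sub]
        refine X_pow_dvd_iff.1 (hdvd (n + 1 + l) k) j ?_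
        have : μ (ι (n + 1)) ≤ μ (ι (n + 1 + l)) := hμι.monotone (Nat.le_add_right _ _)
        omega
    have ht := tendsto_tc isOpen_ball (mem_ball_self one_pos) (fun n => hdiff n k) (hloc k) j
    simp only [tc_polynomial] at ht
    refine tendsto_nhds_unique ht (tendsto_const_nhds.congr' ?_)
    filter_upwards [eventually_ge_atTop (n + 1)] with l hl
    obtain ⟨l, rfl⟩ := Nat.exists_eq_add_of_le hl
    exact (hstab l).symm

theorem exists_frequent_enumeration :
    ∃ τ : ℕ → ℕ × ℕ × ℕ, ∀ x N, ∃ n ≥ N, τ n = x := by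
  refine ⟨fun n => (n.unpair.2.unpair.1, n.unpair.2.unpair.2.unpair), fun ⟨s, m, t⟩ N =>
    ⟨Nat.pair N (Nat.pair s (Nat.pair m t)), Nat.left_le_pair _ _, ?_⟩⟩
  simp

theorem mem_closure_range_of_close {a : ℂ} (ha : 1 ≤ ‖a‖) (q : ℕ) {T : ℕ → ℂ[X]}
    (hT : ∀ K : Set ℂ, IsCompact K → ∀ p : ℂ[X], ∀ ε > 0, ∃ t, ∀ z ∈ K,
      ‖(T t).eval z - p.eval z‖ < ε)
    {f : ℕ → Hol unitD} {g : ℕ → ℂ → ℂ}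
    (hfg : ∀ k, ∀ z ∈ ball (0 : ℂ) 1, (1 - a⁻¹ * z) ^ q * (f k).1 z = g k z)
    (hg : ∀ k : ℕ, ∀ z ∈ closedBall (0 : ℂ) (1 - 1 / ((k : ℝ) + 2)),
      ‖g k z - (T k.unpair.1).eval z‖ ≤ 2 * (1 / 2) ^ k) (φ : Hol unitD) :
    φ ∈ closure (Set.range f) := by
  have hφd : DifferentiableOn ℂ φ.1 (ball 0 1) := φ.2.1
  set ψ : ℂ → ℂ := fun z => (1 - a⁻¹ * z) ^ q * φ.1 z with hψ
  have hψd : DifferentiableOn ℂ ψ (ball 0 1) :=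
    (by fun_prop : Differentiable ℂ fun z : ℂ => (1 - a⁻¹ * z) ^ q).differentiableOn.mul hφd
  have key : ∀ j : ℕ, ∃ k, ∀ z ∈ closedBall (0 : ℂ) (1 - 1 / ((j : ℝ) + 2)),
      ‖ψ z - g k z‖ ≤ 2 * (1 / ((j : ℝ) + 1)) + 2 * (1 / 2) ^ j := by
    intro j
    have hpos : (0 : ℝ) < 1 / ((j : ℝ) + 1) := by positivity
    obtain ⟨p, hp⟩ := PolyApprox.of_differentiableOn hψd
      (sub_lt_self 1 (by positivity : (0 : ℝ) < 1 / ((j : ℝ) + 2))) _ hpos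
    obtain ⟨t, ht⟩ := hT _ (isCompact_closedBall 0 (1 - 1 / ((j : ℝ) + 2))) p _ hpos
    have hjk : j ≤ Nat.pair t j := Nat.right_le_pair _ _
    refine ⟨Nat.pair t j, fun z hz => ?_⟩
    have h1 := hp z hz
    have h2 := ht z hz
    have h3 := hg (Nat.pair t j) z (closedBall_radius_mono hjk hz)
    rw [Nat.unpair_pair] at h3
    have h4 : (1 / 2 : ℝ) ^ Nat.pair t j ≤ (1 / 2) ^ j :=
      pow_le_pow_of_le_one (by norm_num) (by norm_num) hjk
    rw [norm_sub_rev] at h1 h2 h3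
    calc ‖ψ z - g (Nat.pair t j) z‖ = ‖(ψ z - p.eval z) + (p.eval z - (T t).eval z) +
          ((T t).eval z - g (Nat.pair t j) z)‖ := by congr 1; ring
      _ ≤ ‖ψ z - p.eval z‖ + ‖p.eval z - (T t).eval z‖ + ‖(T t).eval z - g (Nat.pair t j) z‖ :=
          norm_add₃_le
      _ ≤ _ := by dsimp only at h3; linarith
  choose k hk using key
  have hlim : Tendsto (fun j : ℕ => 2 * (1 / ((j : ℝ) + 1)) + 2 * (1 / 2) ^ j) atTop (𝓝 0) := by
    simpa using ((tendsto_one_div_add_atTop_nhds_zero_nat (𝕜 := ℝ)).const_mul 2).add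
      ((tendsto_pow_atTop_nhds_zero_of_lt_one (by norm_num : (0 : ℝ) ≤ 1 / 2)
        one_half_lt_one).const_mul 2)
  have hloc := tendstoLocallyUniformlyOn_of_norm_le (F := fun j => g (k j)) hlim hk
  refine mem_closure_of_tendsto (f := fun j => f (k j)) (b := atTop) (tendsto_hol_unitD ?_)
    (.of_forall fun j => Set.mem_range_self _)
  refine (tendstoLocallyUniformlyOn_iff_forall_isCompact (s := unitD) isOpen_ball).2 ?_
  intro L hLD hL
  have hu := (tendstoLocallyUniformlyOn_iff_forall_isCompact isOpen_ball).1 hloc L hLD hL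
  obtain ⟨B, hB⟩ := hL.exists_bound_of_continuousOn (f := fun z => ((1 - a⁻¹ * z) ^ q)⁻¹)
    (ContinuousOn.inv₀ (by fun_prop) fun z hz => one_sub_pow_ne_zero_of_mem_ball ha q (hLD hz))
  refine ((hu.mul_of_bounded hB).congr_right fun z hz => ?_).congr (.of_forall fun j z hz => ?_)
  · simp only [hψ]
    rw [mul_right_comm, mul_inv_cancel₀ (one_sub_pow_ne_zero_of_mem_ball ha q (hLD hz)), one_mul]
  · simp only
    rw [← hfg (k j) z (hLD hz), mul_right_comm,
      mul_inv_cancel₀ (one_sub_pow_ne_zero_of_mem_ball ha q (hLD hz)), one_mul]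

theorem tc_sum {ι : Type*} (s : Finset ι) (c : ι → ℂ) {g : ι → ℂ → ℂ}
    (hg : ∀ k, DifferentiableOn ℂ (g k) (ball 0 1)) (j : ℕ) :
    tc (fun z => ∑ k ∈ s, c k * g k z) j = ∑ k ∈ s, c k * tc (g k) j := by
  have han : ∀ k, AnalyticAt ℂ (g k) 0 := fun k => (hg k).analyticAt (ball_mem_nhds 0 one_pos)
  have h1 : iteratedDeriv j (fun z => ∑ k ∈ s, c k * g k z) 0 =
      ∑ k ∈ s, iteratedDeriv j (fun z => c k * g k z) 0 :=
    iteratedDeriv_fun_sum fun k _ => (contDiffAt_const.mul (han k).contDiffAt)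
  rw [tc, h1, Finset.sum_div]
  refine Finset.sum_congr rfl fun k _ => ?_
  rw [iteratedDeriv_const_mul_field, tc, mul_div_assoc]

theorem sum_mem_UQset {μ : ℕ → ℕ} {a : ℂ} (ha : 1 ≤ ‖a‖) {q : ℕ} (hq : 1 ≤ q)
    {Kf : ℕ → Set ℂ} (hKc : ∀ m, IsCompact (Kf m))
    (hKf : ∀ K, IsCompact K → IsConnected Kᶜ → Disjoint K (ball 0 1) → a ∉ K → ∃ m, K ⊆ Kf m)
    {T : ℕ → ℂ[X]} (hT : ∀ K : Set ℂ, IsCompact K → ∀ p : ℂ[X], ∀ ε > 0, ∃ t, ∀ z ∈ K,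
      ‖(T t).eval z - p.eval z‖ < ε)
    {τ : ℕ → ℕ × ℕ × ℕ} (hτ : ∀ x N, ∃ n ≥ N, τ n = x)
    {f : ℕ → Hol unitD} {g : ℕ → ℂ → ℂ} (hgd : ∀ k, DifferentiableOn ℂ (g k) (ball 0 1))
    (hfg : ∀ k, ∀ z ∈ ball (0 : ℂ) 1, (1 - a⁻¹ * z) ^ q * (f k).1 z = g k z)
    (hg : ∀ n, ∃ i ≥ n, n ≤ μ i ∧ ∃ P : ℕ → ℂ[X], ∀ k ≤ n, (P k).natDegree ≤ μ i ∧
        (P k).eval a = (if k = (τ n).1 then 1 else 0) ∧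
        (∀ j ≤ μ i + q, tc (g k) j = (P k).coeff j) ∧
        ∀ z ∈ Kf (τ n).2.1, ‖(P k).eval z -
          (if k = (τ n).1 then 1 else 0) * (T (τ n).2.2).eval z‖ < (1 / 2) ^ n)
    {c : ℕ →₀ ℂ} (hc : c ≠ 0) :
    (c.sum fun k x => x • f k) ∈
      UQset μ q ((1 - C a⁻¹ * X) ^ q) {z : ℂ | ((1 - C a⁻¹ * X) ^ q).eval z = 0} := by
  obtain ⟨s, hs⟩ := Finsupp.ne_iff.1 hc
  rw [Finsupp.zero_apply] at hs
  have hsc : s ∈ c.support := Finsupp.mem_support_iff.2 hs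
  refine mem_UQset_of_forall ha hq hKf (g := fun z => ∑ k ∈ c.support, c k * g k z)
    (fun z hz => ?_) fun m H ε hε N => ?_
  · rw [Finsupp.sum, AddSubmonoidClass.coe_finsetSum, Finset.sum_apply, Finset.mul_sum]
    refine Finset.sum_congr rfl fun k _ => ?_
    rw [← hfg k z hz]
    simp only [SetLike.val_smul, Pi.smul_apply, smul_eq_mul]
    ring
  · obtain ⟨t, ht⟩ := hT (Kf m) (hKc m) (C (c s)⁻¹ * H) (ε / 2 / ‖c s‖)
      (div_pos (half_pos hε) (norm_pos_iff.2 hs))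
    set A := ∑ k ∈ c.support, ‖c k‖ with hA
    have hA0 : 0 ≤ A := Finset.sum_nonneg fun _ _ => norm_nonneg _
    have hlim : Tendsto (fun n : ℕ => A * (1 / 2 : ℝ) ^ n) atTop (𝓝 0) := by
      simpa using (tendsto_pow_atTop_nhds_zero_of_lt_one (by norm_num : (0 : ℝ) ≤ 1 / 2)
        one_half_lt_one).const_mul A
    obtain ⟨N₁, hN₁⟩ := eventually_atTop.1 (hlim.eventually_lt_const (half_pos hε))
    obtain ⟨n, hn, hτn⟩ := hτ (s, m, t) (N + N₁ + ∑ k ∈ c.support, k)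
    obtain ⟨i, hin, hμi, P, hP⟩ := hg n
    rw [hτn] at hP
    dsimp only at hP
    have hkn : ∀ k ∈ c.support, k ≤ n := by
      intro k hk
      have := Finset.single_le_sum (f := fun k => k) (fun _ _ => Nat.zero_le _) hk
      omega
    refine ⟨i, by omega, by omega, ∑ k ∈ c.support, C (c k) * P k, ?_, ?_, fun j hj => ?_,
      fun z hz => ?_⟩
    · exact natDegree_sum_le_of_forall_le _ _ fun k hk =>
        (natDegree_C_mul_le _ _).trans (hP k (hkn k hk)).1
    · have : (∑ k ∈ c.support, C (c k) * P k).eval a = c s := by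
        rw [eval_finsetSum, Finset.sum_eq_single_of_mem s hsc]
        · simp [(hP s (hkn s hsc)).2.1]
        · intro k hk hks
          simp [(hP k (hkn k hk)).2.1, hks]
      rwa [this]
    · rw [tc_sum _ _ hgd, finsetSum_coeff]
      refine Finset.sum_congr rfl fun k hk => ?_
      rw [coeff_C_mul, (hP k (hkn k hk)).2.2.1 j hj]
    · have h1 : (∑ k ∈ c.support, C (c k) * P k).eval z - H.eval z =
          ∑ k ∈ c.support, c k * ((P k).eval z - (if k = s then 1 else 0) * (T t).eval z) +
          c s * ((T t).eval z - (C (c s)⁻¹ * H).eval z) := by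
        simp only [eval_finsetSum, eval_mul, eval_C, mul_sub, Finset.sum_sub_distrib]
        rw [Finset.sum_eq_single_of_mem (f := fun k => c k * ((if k = s then 1 else 0) *
          (T t).eval z)) s hsc fun k _ hks => by simp [hks]]
        rw [if_pos rfl, mul_inv_cancel_left₀ hs]
        ring
      have h2 : ‖∑ k ∈ c.support, c k * ((P k).eval z - (if k = s then 1 else 0) * (T t).eval z)‖
          ≤ A * (1 / 2) ^ n := by
        rw [hA, Finset.sum_mul]
        refine norm_sum_le_of_le _ fun k hk => ?_
        rw [norm_mul]
        gcongr
        exact ((hP k (hkn k hk)).2.2.2 z hz).le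
      have h3 : ‖c s * ((T t).eval z - (C (c s)⁻¹ * H).eval z)‖ < ε / 2 := by
        rw [norm_mul, mul_comm]
        exact (lt_div_iff₀ (norm_pos_iff.2 hs)).1 (ht z hz)
      rw [h1]
      exact (norm_add_le _ _).trans_lt (by linarith [hN₁ n (by omega)])

/-- Theorem 4.8 (algebraic genericity) : for an unbounded sequence `μ` of positive
integers, `a ∉ 𝔻` and `q ≥ 1`, there is a sequence `(f_k)` in `𝒰_{Q_q}^μ(𝔻)` whose
linear span `F` is dense in `H(𝔻)` and satisfies `F ∖ {0} ⊆ 𝒰̃_{Q_q}^μ(𝔻)`. -/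
theorem stmt_14 (μ : ℕ → ℕ) (hμpos : ∀ k, 0 < μ k) (hμub : ∀ N : ℕ, ∃ k, N < μ k)
    (a : ℂ) (ha : 1 ≤ ‖a‖) (q : ℕ) (hq : 1 ≤ q) :
    ∃ f : ℕ → Hol unitD,
      (∀ k, f k ∈ UQset μ q ((1 - Polynomial.C a⁻¹ * Polynomial.X) ^ q)
        {z : ℂ | ((1 - Polynomial.C a⁻¹ * Polynomial.X) ^ q).eval z = 0}) ∧
      Dense (↑(Submodule.span ℂ (Set.range f)) : Set (Hol unitD)) ∧
      ∀ g ∈ Submodule.span ℂ (Set.range f), g ≠ 0 → g ∈ Utilde μ a q := by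
  obtain ⟨Kf, hKf, hcover⟩ := exists_countable_compact_family a
  obtain ⟨T, hT⟩ := exists_dense_polynomials
  obtain ⟨τ, hτ⟩ := exists_frequent_enumeration
  obtain ⟨g, hgd, hgT, hg⟩ := exists_universal_family hμub ha q hKf T (fun k => T k.unpair.1) τ
  classical
  let f : ℕ → Hol unitD := fun k => ⟨fun z => if z ∈ unitD then g k z / (1 - a⁻¹ * z) ^ q else 0, by
    refine DifferentiableOn.congr (f := fun z => g k z / (1 - a⁻¹ * z) ^ q) ?_
      fun z hz => if_pos hz
    exact (hgd k).div
      (by fun_prop : Differentiable ℂ fun z : ℂ => (1 - a⁻¹ * z) ^ q).differentiableOn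
      fun z hz => one_sub_pow_ne_zero_of_mem_ball ha q hz, fun z hz => if_neg hz⟩
  have hfg : ∀ k, ∀ z ∈ ball (0 : ℂ) 1, (1 - a⁻¹ * z) ^ q * (f k).1 z = g k z := by
    intro k z hz
    have h1 : (f k).1 z = g k z / (1 - a⁻¹ * z) ^ q := if_pos hz
    rw [h1, mul_div_cancel₀ _ (one_sub_pow_ne_zero_of_mem_ball ha q hz)]
  have hsum : ∀ {c : ℕ →₀ ℂ}, c ≠ 0 → (c.sum fun k x => x • f k) ∈
      UQset μ q ((1 - C a⁻¹ * X) ^ q) {z : ℂ | ((1 - C a⁻¹ * X) ^ q).eval z = 0} :=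
    fun hc => sum_mem_UQset ha hq (fun m => (hKf m).1) hcover hT hτ hgd hfg hg hc
  refine ⟨f, fun k => ?_, fun φ => ?_, fun h hh h0 => ?_⟩
  · simpa using hsum (c := Finsupp.single k 1) (by simp)
  · exact closure_mono Submodule.subset_span (mem_closure_range_of_close ha q hT hfg hgT φ)
  · obtain ⟨c, rfl⟩ := Finsupp.mem_span_range_iff_exists_finsupp.1 hh
    refine Set.mem_biUnion (Set.mem_Iic.2 le_rfl) (hsum ?_)
    rintro rfl
    exact h0 Finsupp.sum_zero_index

end
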